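/- Fix real numbers α>0, σ>0 and c2 with 0<c2≤1. For each n∈ℕ let T_n = { x ∈ [−1/√n, 1/√n]^n : ‖x‖₂² = c2 } and set ξ_n = (1/√n)·E[ min_{x∈T_n} ‖A(x_sol − x) + σ v‖₂ ]. Then liminf_{n→∞} ξ_n ≥ inf_{c1 : |c1| ≤ √c2} sup_{γ>0, ν∈ℝ} ξ_RD(α,σ;c2,c1,γ,ν), where ξ_RD(α,σ;c2,c1,γ,ν) = √α·√(1−2c1+c2+σ²) + I22(γ,ν) − I1(γ,ν) + I21(γ,ν) − ν·c1 − γ·c2. -/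

import Mathlib

open MeasureTheory ProbabilityTheory Filter Real

/-- The error function `erf(x) = (2/√π) ∫₀ˣ e^{-t²} dt`. -/
noncomputable def erf (x : ℝ) : ℝ := (2 / Real.sqrt π) * ∫ t in (0:ℝ)..x, Real.exp (-t^2)

/-- The complementary error function. -/
noncomputable def erfc (x : ℝ) : ℝ := 1 - erf x

noncomputable def I22 (γ ν : ℝ) : ℝ :=
  (1/2) * (ν + γ) * erfc ((ν + 2*γ) / Real.sqrt 2)
    - Real.exp (-(ν + 2*γ)^2 / 2) / Real.sqrt (2*π)

noncomputable def I1 (γ ν : ℝ) : ℝ :=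
  (Real.sqrt (π/2) * (ν^2 + 1) * erf ((2*γ - ν) / Real.sqrt 2)
    + Real.sqrt (π/2) * (ν^2 + 1) * erf ((2*γ + ν) / Real.sqrt 2)
    + Real.exp (-(ν + 2*γ)^2 / 2) * (ν - 2*γ)
    - Real.exp (-(ν - 2*γ)^2 / 2) * (ν + 2*γ)) / (4 * Real.sqrt (2*π) * γ)

noncomputable def I21 (γ ν : ℝ) : ℝ :=
  -(1/2) * (ν - γ) * (erf ((ν - 2*γ) / Real.sqrt 2) + 1)
    - Real.exp (-(ν - 2*γ)^2 / 2) / Real.sqrt (2*π)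

/-- The random dual objective `ξ_RD(α,σ;c2,c1,γ,ν)`. -/
noncomputable def xiRD (α σ c2 c1 γ ν : ℝ) : ℝ :=
  Real.sqrt α * Real.sqrt (1 - 2*c1 + c2 + σ^2)
    + I22 γ ν - I1 γ ν + I21 γ ν - ν*c1 - γ*c2

/-- The standard Gaussian measure on `τ → ℝ`. -/
noncomputable abbrev stdGaussianPi (τ : Type*) [Fintype τ] : Measure (τ → ℝ) :=
  Measure.pi fun _ : τ => gaussianReal 0 1

lemma integrable_gaussianReal_iff {f : ℝ → ℝ} :
    Integrable f (gaussianReal 0 1) ↔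
      Integrable (fun x => gaussianPDFReal 0 1 x * f x) := by
  rw [gaussianReal_of_var_ne_zero _ one_ne_zero,
    integrable_withDensity_iff_integrable_smul' (measurable_gaussianPDF 0 1)
      (Eventually.of_forall fun x => gaussianPDF_lt_top)]
  simp [toReal_gaussianPDF]

lemma integral_gaussianReal_eq {f : ℝ → ℝ} :
    ∫ x, f x ∂gaussianReal 0 1 = ∫ x, gaussianPDFReal 0 1 x * f x := by
  rw [integral_gaussianReal_eq_integral_smul one_ne_zero]; simp

lemma gaussianPDFReal_zero_one (x : ℝ) :
    gaussianPDFReal 0 1 x = (√(2 * π))⁻¹ * rexp (-x ^ 2 / 2) := by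
  simp [gaussianPDFReal]

lemma hasDerivAt_gaussianPDFReal (x : ℝ) :
    HasDerivAt (gaussianPDFReal 0 1) (-(x * gaussianPDFReal 0 1 x)) x := by
  have h : HasDerivAt (fun y : ℝ => (√(2 * π))⁻¹ * rexp (-y ^ 2 / 2))
      ((√(2 * π))⁻¹ * (rexp (-x ^ 2 / 2) * (-(2 * x) / 2))) x := by
    refine HasDerivAt.const_mul _ (HasDerivAt.exp ?_)
    simpa using ((hasDerivAt_pow 2 x).neg.div_const 2)
  rw [show gaussianPDFReal 0 1 = fun y : ℝ => (√(2 * π))⁻¹ * rexp (-y ^ 2 / 2) from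
    funext gaussianPDFReal_zero_one]
  convert h using 1
  ring

lemma integrable_id_gaussianReal : Integrable (fun x : ℝ => x) (gaussianReal 0 1) :=
  (memLp_id_gaussianReal 1).integrable le_rfl

lemma integrable_sq_gaussianReal : Integrable (fun x : ℝ => x ^ 2) (gaussianReal 0 1) :=
  (memLp_id_gaussianReal 2).integrable_sq

/-- Stein's identity for a bounded function with bounded derivative. -/
lemma integral_mul_gaussianReal_eq_integral_deriv {f f' : ℝ → ℝ} {C : ℝ}
    (hf : ∀ x, HasDerivAt f (f' x) x) (hfC : ∀ x, |f x| ≤ C) (hf'C : ∀ x, |f' x| ≤ C) :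
    ∫ x, x * f x ∂gaussianReal 0 1 = ∫ x, f' x ∂gaussianReal 0 1 := by
  have hfm : Measurable f :=
    (continuous_iff_continuousAt.2 fun x => (hf x).continuousAt).measurable
  have hf'm : Measurable f' := by
    rw [show f' = deriv f from funext fun x => (hf x).deriv.symm]; exact measurable_deriv f
  have i1 : Integrable f (gaussianReal 0 1) :=
    Integrable.of_bound hfm.aestronglyMeasurable C (Eventually.of_forall hfC)
  have i2 : Integrable f' (gaussianReal 0 1) :=
    Integrable.of_bound hf'm.aestronglyMeasurable C (Eventually.of_forall hf'C)
  have i3 : Integrable (fun x => x * f x) (gaussianReal 0 1) :=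
    integrable_id_gaussianReal.mul_bdd hfm.aestronglyMeasurable (c := C) (Eventually.of_forall hfC)
  rw [integrable_gaussianReal_iff] at i1 i2 i3
  have key := integral_mul_deriv_eq_deriv_mul_of_integrable (u := f) (u' := f')
    (v := gaussianPDFReal 0 1) (v' := fun x => -(x * gaussianPDFReal 0 1 x))
    (fun x _ => hf x) (fun x _ => hasDerivAt_gaussianPDFReal x)
    (by convert i3.neg using 1; ext x; simp; ring)
    (by convert i2 using 1; ext x; simp; ring)
    (by convert i1 using 1; ext x; simp; ring)
  rw [integral_gaussianReal_eq, integral_gaussianReal_eq]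
  have e1 : ∫ x, f x * -(x * gaussianPDFReal 0 1 x) =
      -∫ x, gaussianPDFReal 0 1 x * (x * f x) := by
    rw [← integral_neg]; congr 1; ext x; ring
  have e2 : ∫ x, f' x * gaussianPDFReal 0 1 x = ∫ x, gaussianPDFReal 0 1 x * f' x := by
    congr 1; ext x; ring
  linarith

section Pi
variable {τ : Type*} [Fintype τ] [DecidableEq τ]

/-- Resampling one coordinate preserves a product probability measure. -/
lemma measurePreserving_update (μ : Measure ℝ) [IsProbabilityMeasure μ] (a : τ) :
    MeasurePreserving (fun p : (τ → ℝ) × ℝ => Function.update p.1 a p.2)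
      ((Measure.pi fun _ => μ).prod μ) (Measure.pi fun _ : τ => μ) := by
  have hm : Measurable (fun p : (τ → ℝ) × ℝ => Function.update p.1 a p.2) := by
    refine measurable_pi_lambda _ fun b => ?_
    by_cases h : b = a
    · subst h; simpa using measurable_snd
    · simp only [Function.update_of_ne h]; fun_prop
  refine ⟨hm, (Measure.pi_eq fun s hs => ?_).symm⟩
  rw [Measure.map_apply hm (MeasurableSet.univ_pi hs)]
  have : (fun p : (τ → ℝ) × ℝ => Function.update p.1 a p.2) ⁻¹' (Set.univ.pi s) =
      (Set.univ.pi (Function.update s a Set.univ)) ×ˢ s a := by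
    ext p
    simp only [Set.mem_preimage, Set.mem_univ_pi, Set.mem_prod]
    constructor
    · refine fun h => ⟨fun b => ?_, by simpa using h a⟩
      by_cases hb : b = a
      · subst hb; simp
      · simpa [hb] using h b
    · rintro ⟨h, h'⟩ b
      by_cases hb : b = a
      · subst hb; simpa using h'
      · simpa [hb] using h b
  rw [this, Measure.prod_prod, Measure.pi_pi, ← Finset.mul_prod_erase _ _ (Finset.mem_univ a),
    ← Finset.mul_prod_erase _ (fun i => μ (s i)) (Finset.mem_univ a)]
  simp only [Function.update_self, measure_univ, one_mul]
  rw [mul_comm]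
  congr 1
  refine Finset.prod_congr rfl fun b hb => ?_
  rw [Function.update_of_ne (Finset.ne_of_mem_erase hb)]

/-- Gaussian integration by parts in one coordinate. -/
lemma integral_eval_mul_stdGaussianPi {G G' : (τ → ℝ) → ℝ} {C : ℝ} (a : τ)
    (hG : ∀ ξ, HasDerivAt (fun s => G (Function.update ξ a s)) (G' ξ) (ξ a))
    (hGc : Continuous G) (hG'c : Continuous G')
    (hGC : ∀ ξ, |G ξ| ≤ C) (hG'C : ∀ ξ, |G' ξ| ≤ C) :
    ∫ ξ, ξ a * G ξ ∂stdGaussianPi τ = ∫ ξ, G' ξ ∂stdGaussianPi τ := by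
  have hmp := measurePreserving_update (τ := τ) (gaussianReal 0 1) a
  have i1 : Integrable (fun ξ : τ → ℝ => ξ a * G ξ) (stdGaussianPi τ) := by
    refine Integrable.mul_bdd ?_ hGc.aestronglyMeasurable (c := C) (Eventually.of_forall hGC)
    exact (measurePreserving_eval (fun _ : τ => gaussianReal 0 1) a).integrable_comp_of_integrable
      integrable_id_gaussianReal
  have i2 : Integrable G' (stdGaussianPi τ) :=
    Integrable.of_bound hG'c.aestronglyMeasurable C (Eventually.of_forall hG'C)
  have e : ∀ H : (τ → ℝ) → ℝ, Integrable H (stdGaussianPi τ) →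
      ∫ ξ, H ξ ∂stdGaussianPi τ =
        ∫ ξ, ∫ s, H (Function.update ξ a s) ∂gaussianReal 0 1 ∂stdGaussianPi τ := by
    intro H hH
    have h1 := integral_map hmp.aemeasurable (f := H) (by rw [hmp.map_eq]; exact hH.1)
    rw [hmp.map_eq] at h1
    rw [stdGaussianPi, h1]
    exact integral_prod _ (hmp.integrable_comp_of_integrable hH)
  rw [e _ i1, e _ i2]
  congr 1; ext ξ
  simp only [Function.update_self]
  refine integral_mul_gaussianReal_eq_integral_deriv (C := C) (fun x => ?_)
    (fun x => hGC _) (fun x => hG'C _)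
  simpa using hG (Function.update ξ a x)

end Pi

section Interpolation
variable {E : Type*} [NormedAddCommGroup E] [NormedSpace ℝ E] {τ : Type*} [Fintype τ]

lemma abs_sub_le_of_norm_fderiv_le {F : E → ℝ} (hF : Differentiable ℝ F) {C : ℝ}
    (hC : ∀ z, ‖fderiv ℝ F z‖ ≤ C) (x y : E) : |F x - F y| ≤ C * ‖x - y‖ := by
  simpa using convex_univ.norm_image_sub_le_of_norm_fderiv_le (𝕜 := ℝ)
    (fun z _ => hF z) (fun z _ => hC z) (Set.mem_univ y) (Set.mem_univ x)

lemma integrable_eval_stdGaussianPi (a : τ) :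
    Integrable (fun ξ : τ → ℝ => ξ a) (stdGaussianPi τ) :=
  (measurePreserving_eval (fun _ : τ => gaussianReal 0 1) a).integrable_comp_of_integrable
    integrable_id_gaussianReal

lemma integrable_sum_abs_mul_stdGaussianPi (r : τ → ℝ) :
    Integrable (fun ξ : τ → ℝ => ∑ a, |ξ a| * r a) (stdGaussianPi τ) :=
  integrable_finsetSum _ fun a _ => ((integrable_eval_stdGaussianPi a).abs).mul_const _

lemma norm_sum_mul_smul_le (c ξ : τ → ℝ) (hc : ∀ a, |c a| ≤ 1) (v : τ → E) :
    ‖∑ a, (c a * ξ a) • v a‖ ≤ ∑ a, |ξ a| * ‖v a‖ := by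
  refine (norm_sum_le _ _).trans (Finset.sum_le_sum fun a _ => ?_)
  rw [norm_smul, Real.norm_eq_abs, abs_mul]
  have := mul_le_mul_of_nonneg_right (hc a) (abs_nonneg (ξ a))
  rw [one_mul] at this
  gcongr

lemma integrable_comp_sum_smul {F : E → ℝ} (hF : Differentiable ℝ F) {C : ℝ}
    (hC : ∀ z, ‖fderiv ℝ F z‖ ≤ C) (c : τ → ℝ) (hc : ∀ a, |c a| ≤ 1) (v : τ → E) :
    Integrable (fun ξ : τ → ℝ => F (∑ a, (c a * ξ a) • v a)) (stdGaussianPi τ) := by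
  have hcont : Continuous fun ξ : τ → ℝ => F (∑ a, (c a * ξ a) • v a) :=
    hF.continuous.comp (by fun_prop)
  have hC0 : 0 ≤ C := (norm_nonneg _).trans (hC 0)
  refine Integrable.mono' ((integrable_const |F 0|).add
    ((integrable_sum_abs_mul_stdGaussianPi fun a => ‖v a‖).const_mul C))
    hcont.aestronglyMeasurable (Eventually.of_forall fun ξ => ?_)
  have h1 := abs_sub_le_of_norm_fderiv_le hF hC (∑ a, (c a * ξ a) • v a) 0
  rw [sub_zero] at h1
  have h2 := mul_le_mul_of_nonneg_left (norm_sum_mul_smul_le c ξ hc v) hC0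
  have h3 := abs_sub_abs_le_abs_sub (F (∑ a, (c a * ξ a) • v a)) (F 0)
  simp only [Pi.add_apply, Real.norm_eq_abs]
  linarith

lemma hasDerivAt_fderiv_line {F : E → ℝ} (hF : ContDiff ℝ 2 F) (z v : E) (s : ℝ) :
    HasDerivAt (fun s : ℝ => fderiv ℝ F (z + s • v) v)
      (fderiv ℝ (fderiv ℝ F) (z + s • v) v v) s := by
  have hF1 : ContDiff ℝ 1 (fderiv ℝ F) := hF.fderiv_right (by norm_num)
  have hl : HasDerivAt (fun s : ℝ => z + s • v) v s := by
    simpa using ((hasDerivAt_id s).smul_const v).const_add z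
  have hd := ((hF1.differentiable (by norm_num) (z + s • v)).hasFDerivAt).comp_hasDerivAt s hl
  exact ((ContinuousLinearMap.apply ℝ ℝ v).hasFDerivAt).comp_hasDerivAt s hd

/-- Integration by parts for the derivative of a function of a Gaussian sum. -/
lemma integral_eval_mul_fderiv_sum_smul {F : E → ℝ} (hF : ContDiff ℝ 2 F) {C C' : ℝ}
    (hC : ∀ z, ‖fderiv ℝ F z‖ ≤ C) (v : τ → E) (a : τ)
    (hC' : ∀ z, |fderiv ℝ (fderiv ℝ F) z (v a) (v a)| ≤ C')
    (c : τ → ℝ) (hc : ∀ a, |c a| ≤ 1) :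
    ∫ ξ, ξ a * fderiv ℝ F (∑ b, (c b * ξ b) • v b) (v a) ∂stdGaussianPi τ =
      c a * ∫ ξ, fderiv ℝ (fderiv ℝ F) (∑ b, (c b * ξ b) • v b) (v a) (v a)
        ∂stdGaussianPi τ := by
  classical
  have hF1 : ContDiff ℝ 1 (fderiv ℝ F) := hF.fderiv_right (by norm_num)
  have hF2 : Continuous (fderiv ℝ (fderiv ℝ F)) := hF1.continuous_fderiv (by norm_num)
  have hZ : Continuous fun ξ : τ → ℝ => ∑ b, (c b * ξ b) • v b := by fun_prop
  rw [← integral_const_mul]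
  refine integral_eval_mul_stdGaussianPi (C := max (C * ‖v a‖) C') a (fun ξ => ?_)
    (((hF1.continuous.comp hZ).clm_apply continuous_const)) ?_ (fun ξ => ?_) (fun ξ => ?_)
  · have e : ∀ s, ∑ b, (c b * Function.update ξ a s b) • v b =
        ∑ b, (c b * ξ b) • v b + ((s - ξ a) * c a) • v a := by
      intro s
      rw [← Finset.add_sum_erase _ _ (Finset.mem_univ a),
        ← Finset.add_sum_erase _ (fun b => (c b * ξ b) • v b) (Finset.mem_univ a)]
      have : ∀ b ∈ Finset.univ.erase a, (c b * Function.update ξ a s b) • v b =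
          (c b * ξ b) • v b := fun b hb => by
        rw [Function.update_of_ne (Finset.ne_of_mem_erase hb)]
      rw [Finset.sum_congr rfl this, Function.update_self,
        show c a * s = c a * ξ a + (s - ξ a) * c a by ring, add_smul]
      abel
    simp only [e]
    have hl : HasDerivAt (fun s : ℝ => (s - ξ a) * c a) (c a) (ξ a) := by
      simpa using ((hasDerivAt_id (ξ a)).sub_const (ξ a)).mul_const (c a)
    have := (hasDerivAt_fderiv_line hF (∑ b, (c b * ξ b) • v b) (v a) ((ξ a - ξ a) * c a)).comp
      (ξ a) hl
    simpa [Function.comp_def, mul_comm] using this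
  · exact continuous_const.mul
      (((hF2.comp hZ).clm_apply continuous_const).clm_apply continuous_const)
  · refine le_max_of_le_left ?_
    rw [← Real.norm_eq_abs]
    exact (ContinuousLinearMap.le_opNorm _ _).trans (by gcongr; exact hC _)
  · refine le_max_of_le_right ?_
    rw [abs_mul]
    have := mul_le_mul (hc a) (hC' (∑ b, (c b * ξ b) • v b)) (abs_nonneg _) zero_le_one
    rwa [one_mul] at this

lemma hasDerivAt_integral_sum_smul {F : E → ℝ} (hF : ContDiff ℝ 2 F) {C C' : ℝ}
    (hC : ∀ z, ‖fderiv ℝ F z‖ ≤ C) (v : τ → E)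
    (hC' : ∀ a z, |fderiv ℝ (fderiv ℝ F) z (v a) (v a)| ≤ C')
    {c c' : ℝ → τ → ℝ} (hc : ∀ t a, |c t a| ≤ 1) (hc' : ∀ t a, |c' t a| ≤ 1)
    (hcc' : ∀ t a, HasDerivAt (fun s => c s a) (c' t a) t) (t : ℝ) :
    HasDerivAt (fun s => ∫ ξ, F (∑ a, (c s a * ξ a) • v a) ∂stdGaussianPi τ)
      (∑ a, c' t a * (c t a * ∫ ξ, fderiv ℝ (fderiv ℝ F) (∑ b, (c t b * ξ b) • v b) (v a) (v a)
        ∂stdGaussianPi τ)) t := by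
  have hFd : Differentiable ℝ F := hF.differentiable (by norm_num)
  have hF1 : Continuous (fderiv ℝ F) := hF.continuous_fderiv (by norm_num)
  have hC0 : 0 ≤ C := (norm_nonneg _).trans (hC 0)
  have hZ : ∀ c : τ → ℝ, Continuous fun ξ : τ → ℝ => ∑ b, (c b * ξ b) • v b := by
    intro c; fun_prop
  have key := hasDerivAt_integral_of_dominated_loc_of_deriv_le (μ := stdGaussianPi τ)
    (F := fun s ξ => F (∑ a, (c s a * ξ a) • v a))
    (F' := fun s ξ => fderiv ℝ F (∑ a, (c s a * ξ a) • v a) (∑ a, (c' s a * ξ a) • v a))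
    (x₀ := t) (s := Set.univ) (bound := fun ξ => C * ∑ a, |ξ a| * ‖v a‖)
    univ_mem
    (Eventually.of_forall fun s => (hFd.continuous.comp (hZ _)).aestronglyMeasurable)
    (integrable_comp_sum_smul hFd hC _ (hc t) v)
    ((hF1.comp (hZ _)).clm_apply (hZ _)).aestronglyMeasurable
    (Eventually.of_forall fun ξ s _ =>
      (ContinuousLinearMap.le_opNorm _ _).trans
        (mul_le_mul (hC _) (norm_sum_mul_smul_le _ ξ (hc' s) v) (norm_nonneg _) hC0))
    ((integrable_sum_abs_mul_stdGaussianPi _).const_mul C)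
    (Eventually.of_forall fun ξ s _ => by
      refine (hFd _).hasFDerivAt.comp_hasDerivAt s ?_
      exact HasDerivAt.fun_sum fun a _ => ((hcc' s a).mul_const _).smul_const _)
  refine key.2.congr_deriv ?_
  have e : ∀ ξ : τ → ℝ,
      fderiv ℝ F (∑ a, (c t a * ξ a) • v a) (∑ a, (c' t a * ξ a) • v a) =
        ∑ a, c' t a * (ξ a * fderiv ℝ F (∑ a, (c t a * ξ a) • v a) (v a)) := by
    intro ξ
    simp only [map_sum, map_smul, smul_eq_mul, mul_assoc]
  simp only [e]
  rw [integral_finsetSum]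
  · refine Finset.sum_congr rfl fun a _ => ?_
    rw [integral_const_mul, integral_eval_mul_fderiv_sum_smul hF hC v a (hC' a) _ (hc t)]
  · intro a _
    refine Integrable.const_mul (Integrable.mul_bdd (c := C * ‖v a‖)
      (integrable_eval_stdGaussianPi a)
      ((hF1.comp (hZ _)).clm_apply continuous_const).aestronglyMeasurable
      (Eventually.of_forall fun ξ => ?_)) _
    exact (ContinuousLinearMap.le_opNorm _ _).trans (by gcongr; exact hC _)

/-- **Gaussian comparison.** If the second-order forms of `F` along the directions `u` are
dominated by those along `v`, then so are the Gaussian averages of `F`. -/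
theorem integral_comp_sum_smul_le {ι κ : Type*} [Fintype ι] [Fintype κ]
    {F : E → ℝ} (hF : ContDiff ℝ 2 F) {C C' : ℝ}
    (hC : ∀ z, ‖fderiv ℝ F z‖ ≤ C) (v : ι → E) (u : κ → E)
    (hv : ∀ a z, |fderiv ℝ (fderiv ℝ F) z (v a) (v a)| ≤ C')
    (hu : ∀ b z, |fderiv ℝ (fderiv ℝ F) z (u b) (u b)| ≤ C')
    (h : ∀ z, ∑ b, fderiv ℝ (fderiv ℝ F) z (u b) (u b) ≤
      ∑ a, fderiv ℝ (fderiv ℝ F) z (v a) (v a)) :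
    ∫ ξ, F (∑ b, ξ (Sum.inr b) • u b) ∂stdGaussianPi (ι ⊕ κ) ≤
      ∫ ξ, F (∑ a, ξ (Sum.inl a) • v a) ∂stdGaussianPi (ι ⊕ κ) := by
  have hF1 : ContDiff ℝ 1 (fderiv ℝ F) := hF.fderiv_right (by norm_num)
  have hF2 : Continuous (fderiv ℝ (fderiv ℝ F)) := hF1.continuous_fderiv (by norm_num)
  set w : ι ⊕ κ → E := Sum.elim v u
  have hw : ∀ a z, |fderiv ℝ (fderiv ℝ F) z (w a) (w a)| ≤ C' := by
    rintro (a | b) z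
    · exact hv a z
    · exact hu b z
  set c : ℝ → ι ⊕ κ → ℝ := fun t => Sum.elim (fun _ => sin t) (fun _ => cos t)
  set c' : ℝ → ι ⊕ κ → ℝ := fun t => Sum.elim (fun _ => cos t) (fun _ => -sin t)
  have hc : ∀ t a, |c t a| ≤ 1 := by
    rintro t (a | b)
    · exact abs_sin_le_one t
    · exact abs_cos_le_one t
  have hc' : ∀ t a, |c' t a| ≤ 1 := by
    rintro t (a | b)
    · exact abs_cos_le_one t
    · simpa [c'] using abs_sin_le_one t
  have hcc' : ∀ t a, HasDerivAt (fun s => c s a) (c' t a) t := by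
    rintro t (a | b)
    · exact hasDerivAt_sin t
    · exact hasDerivAt_cos t
  have hd := hasDerivAt_integral_sum_smul hF hC w hw hc hc' hcc'
  have hmono : MonotoneOn
      (fun s => ∫ ξ, F (∑ a, (c s a * ξ a) • w a) ∂stdGaussianPi (ι ⊕ κ))
      (Set.Icc 0 (π / 2)) := by
    refine monotoneOn_of_deriv_nonneg (convex_Icc _ _)
      (fun t _ => (hd t).continuousAt.continuousWithinAt)
      (fun t _ => (hd t).differentiableAt.differentiableWithinAt) (fun t ht => ?_)
    rw [interior_Icc] at ht
    rw [(hd t).deriv, Fintype.sum_sum_type]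
    simp only [c, c', w, Sum.elim_inl, Sum.elim_inr]
    rw [← Finset.mul_sum, ← Finset.mul_sum, ← Finset.mul_sum, ← Finset.mul_sum]
    have hs : 0 ≤ sin t := (sin_pos_of_pos_of_lt_pi ht.1 (by linarith [ht.2, pi_pos])).le
    have hcs : 0 ≤ cos t := cos_nonneg_of_mem_Icc ⟨by linarith [ht.1, pi_pos], ht.2.le⟩
    have hi : ∀ a, Integrable (fun ξ => fderiv ℝ (fderiv ℝ F)
        (∑ b, (c t b * ξ b) • w b) (w a) (w a)) (stdGaussianPi (ι ⊕ κ)) := by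
      intro a
      have hZ : Continuous fun ξ : ι ⊕ κ → ℝ => ∑ b, (c t b * ξ b) • w b := by fun_prop
      exact Integrable.of_bound (((hF2.comp hZ).clm_apply continuous_const).clm_apply
        continuous_const).aestronglyMeasurable C' (Eventually.of_forall fun ξ => hw a _)
    have hle : ∑ b, ∫ ξ, fderiv ℝ (fderiv ℝ F) (∑ b, (c t b * ξ b) • w b) (u b) (u b)
          ∂stdGaussianPi (ι ⊕ κ) ≤
        ∑ a, ∫ ξ, fderiv ℝ (fderiv ℝ F) (∑ b, (c t b * ξ b) • w b) (v a) (v a)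
          ∂stdGaussianPi (ι ⊕ κ) := by
      have hia : ∀ a, Integrable (fun ξ => fderiv ℝ (fderiv ℝ F)
        (∑ b, (c t b * ξ b) • w b) (v a) (v a)) (stdGaussianPi (ι ⊕ κ)) := fun a => hi (Sum.inl a)
      have hib : ∀ b, Integrable (fun ξ => fderiv ℝ (fderiv ℝ F)
        (∑ b, (c t b * ξ b) • w b) (u b) (u b)) (stdGaussianPi (ι ⊕ κ)) := fun b => hi (Sum.inr b)
      rw [← integral_finsetSum _ fun a _ => hia a, ← integral_finsetSum _ fun b _ => hib b]
      exact integral_mono (integrable_finsetSum _ fun b _ => hib b)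
        (integrable_finsetSum _ fun a _ => hia a) (fun ξ => h _)
    have := mul_le_mul_of_nonneg_left hle (mul_nonneg hcs hs)
    simp only [c, w] at this ⊢
    linarith
  have h0 := hmono (Set.left_mem_Icc.2 (by positivity)) (Set.right_mem_Icc.2 (by positivity))
    (by positivity)
  simpa [c, w, Fintype.sum_sum_type] using h0

end Interpolation

section SoftMin
variable {X : Type*} [Fintype X]

/-- The Gibbs weights of a finite family of energies. -/
noncomputable def gibbsWeight (β : ℝ) (Φ : X → ℝ) (x : X) : ℝ :=
  rexp (-β * Φ x) / ∑ y, rexp (-β * Φ y)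

/-- The smooth minimum of a finite family. -/
noncomputable def softMin (β : ℝ) (Φ : X → ℝ) : ℝ :=
  -(1 / β) * Real.log (∑ y, rexp (-β * Φ y))

lemma softMin_le {β : ℝ} (hβ : 0 < β) (Φ : X → ℝ) (x : X) : softMin β Φ ≤ Φ x := by
  have h1 : rexp (-β * Φ x) ≤ ∑ y, rexp (-β * Φ y) :=
    Finset.single_le_sum (f := fun y => rexp (-β * Φ y)) (fun _ _ => (exp_pos _).le)
      (Finset.mem_univ x)
  have h2 := Real.log_le_log (exp_pos _) h1
  rw [Real.log_exp] at h2
  have h3 : -(1 / β) * Real.log (∑ y, rexp (-β * Φ y)) ≤ -(1 / β) * (-β * Φ x) :=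
    mul_le_mul_of_nonpos_left h2 (by rw [neg_nonpos]; positivity)
  calc _ ≤ _ := h3
    _ = Φ x := by field_simp

variable [Nonempty X]

lemma sum_exp_pos (β : ℝ) (Φ : X → ℝ) : 0 < ∑ y, rexp (-β * Φ y) :=
  Finset.sum_pos (fun _ _ => exp_pos _) Finset.univ_nonempty

lemma gibbsWeight_nonneg (β : ℝ) (Φ : X → ℝ) (x : X) : 0 ≤ gibbsWeight β Φ x :=
  div_nonneg (exp_pos _).le (sum_exp_pos β Φ).le

lemma sum_gibbsWeight (β : ℝ) (Φ : X → ℝ) : ∑ x, gibbsWeight β Φ x = 1 := by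
  simp only [gibbsWeight]
  rw [← Finset.sum_div, div_self (sum_exp_pos β Φ).ne']

lemma abs_sum_gibbsWeight_mul_le (β : ℝ) (Φ : X → ℝ) {r : X → ℝ} {M : ℝ} (h : ∀ x, |r x| ≤ M) :
    |∑ x, gibbsWeight β Φ x * r x| ≤ M := by
  calc |∑ x, gibbsWeight β Φ x * r x| ≤ ∑ x, |gibbsWeight β Φ x * r x| :=
        Finset.abs_sum_le_sum_abs _ _
    _ ≤ ∑ x, gibbsWeight β Φ x * M := Finset.sum_le_sum fun x _ => by
        rw [abs_mul, abs_of_nonneg (gibbsWeight_nonneg β Φ x)]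
        exact mul_le_mul_of_nonneg_left (h x) (gibbsWeight_nonneg β Φ x)
    _ = M := by rw [← Finset.sum_mul, sum_gibbsWeight, one_mul]

lemma sub_log_card_div_le_softMin {β : ℝ} (hβ : 0 < β) (Φ : X → ℝ) {b : ℝ} (hb : ∀ x, b ≤ Φ x) :
    b - Real.log (Fintype.card X) / β ≤ softMin β Φ := by
  have hc : (0 : ℝ) < Fintype.card X := by exact_mod_cast Fintype.card_pos
  have h1 : ∑ y, rexp (-β * Φ y) ≤ Fintype.card X * rexp (-β * b) := by
    calc _ ≤ ∑ _y : X, rexp (-β * b) := Finset.sum_le_sum fun y _ =>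
          exp_le_exp.2 (mul_le_mul_of_nonpos_left (hb y) (by linarith))
      _ = _ := by simp
  have h2 := Real.log_le_log (sum_exp_pos β Φ) h1
  rw [Real.log_mul hc.ne' (exp_pos _).ne', Real.log_exp] at h2
  have h3 : -(1 / β) * (Real.log (Fintype.card X) + -β * b) ≤ softMin β Φ :=
    mul_le_mul_of_nonpos_left h2 (by rw [neg_nonpos]; positivity)
  calc _ = -(1 / β) * (Real.log (Fintype.card X) + -β * b) := by field_simp; ring
    _ ≤ _ := h3

lemma hasDerivAt_softMin {β : ℝ} (hβ : 0 < β) {Φ : ℝ → X → ℝ} {Φ' : X → ℝ} {s : ℝ}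
    (h : ∀ x, HasDerivAt (fun t => Φ t x) (Φ' x) s) :
    HasDerivAt (fun t => softMin β (Φ t)) (∑ x, gibbsWeight β (Φ s) x * Φ' x) s := by
  have h1 : HasDerivAt (fun t => ∑ y, rexp (-β * Φ t y))
      (∑ y, rexp (-β * Φ s y) * (-β * Φ' y)) s :=
    HasDerivAt.fun_sum fun y _ => ((h y).const_mul (-β)).exp
  refine ((h1.log (sum_exp_pos β (Φ s)).ne').const_mul (-(1 / β))).congr_deriv ?_
  rw [Finset.sum_div, Finset.mul_sum]
  refine Finset.sum_congr rfl fun x _ => ?_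
  rw [gibbsWeight]
  field_simp

lemma hasDerivAt_sum_gibbsWeight_mul {β : ℝ} {Φ Φ' : ℝ → X → ℝ} {Φ'' : X → ℝ} {s : ℝ}
    (h : ∀ x, HasDerivAt (fun t => Φ t x) (Φ' s x) s)
    (h' : ∀ x, HasDerivAt (fun t => Φ' t x) (Φ'' x) s) :
    HasDerivAt (fun t => ∑ x, gibbsWeight β (Φ t) x * Φ' t x)
      (∑ x, gibbsWeight β (Φ s) x * Φ'' x - β * ∑ x, gibbsWeight β (Φ s) x * Φ' s x ^ 2 +
        β * (∑ x, gibbsWeight β (Φ s) x * Φ' s x) ^ 2) s := by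
  have hS := (sum_exp_pos β (Φ s)).ne'
  have he : ∀ x, HasDerivAt (fun t => rexp (-β * Φ t x)) (rexp (-β * Φ s x) * (-β * Φ' s x)) s :=
    fun x => ((h x).const_mul (-β)).exp
  have h1 : HasDerivAt (fun t => ∑ y, rexp (-β * Φ t y))
      (∑ y, rexp (-β * Φ s y) * (-β * Φ' s y)) s := HasDerivAt.fun_sum fun y _ => he y
  have h2 : HasDerivAt (fun t => ∑ x, rexp (-β * Φ t x) * Φ' t x)
      (∑ x, (rexp (-β * Φ s x) * (-β * Φ' s x) * Φ' s x + rexp (-β * Φ s x) * Φ'' x)) s :=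
    HasDerivAt.fun_sum fun x _ => (he x).mul (h' x)
  have e : (fun t => ∑ x, gibbsWeight β (Φ t) x * Φ' t x) =
      fun t => (∑ x, rexp (-β * Φ t x) * Φ' t x) / ∑ y, rexp (-β * Φ t y) := by
    ext t
    rw [Finset.sum_div]
    refine Finset.sum_congr rfl fun x _ => ?_
    rw [gibbsWeight]; ring
  rw [e]
  refine (h2.div h1 hS).congr_deriv ?_
  have e1 : ∀ r : X → ℝ, ∑ x, gibbsWeight β (Φ s) x * r x =
      (∑ x, rexp (-β * Φ s x) * r x) / ∑ y, rexp (-β * Φ s y) := by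
    intro r
    rw [Finset.sum_div]
    refine Finset.sum_congr rfl fun x _ => ?_
    rw [gibbsWeight]; ring
  rw [e1, e1, e1]
  have e2 : ∑ x, (rexp (-β * Φ s x) * (-β * Φ' s x) * Φ' s x + rexp (-β * Φ s x) * Φ'' x) =
      -β * (∑ x, rexp (-β * Φ s x) * Φ' s x ^ 2) + ∑ x, rexp (-β * Φ s x) * Φ'' x := by
    rw [Finset.sum_add_distrib, Finset.mul_sum]
    congr 1
    exact Finset.sum_congr rfl fun x _ => by ring
  have e3 : ∑ y, rexp (-β * Φ s y) * (-β * Φ' s y) =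
      -β * ∑ y, rexp (-β * Φ s y) * Φ' s y := by
    rw [Finset.mul_sum]
    exact Finset.sum_congr rfl fun x _ => by ring
  rw [e2, e3]
  field_simp
  ring

end SoftMin

section SmoothNorm
variable {K : Type*} [Fintype K]

/-- A smooth version of `(u, r) ↦ ‖u‖₂ + r`. -/
noncomputable def smoothNorm (δ : ℝ) (p : (K → ℝ) × ℝ) : ℝ := √(δ + ∑ k, p.1 k ^ 2) + p.2

/-- The directional derivative of `smoothNorm`. -/
noncomputable def smoothNormDeriv (δ : ℝ) (p q : (K → ℝ) × ℝ) : ℝ :=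
  (∑ k, p.1 k * q.1 k) / √(δ + ∑ k, p.1 k ^ 2) + q.2

/-- The second directional derivative of `smoothNorm`. -/
noncomputable def smoothNormDeriv₂ (δ : ℝ) (p q : (K → ℝ) × ℝ) : ℝ :=
  (∑ k, q.1 k ^ 2) / √(δ + ∑ k, p.1 k ^ 2) -
    (∑ k, p.1 k * q.1 k) ^ 2 / √(δ + ∑ k, p.1 k ^ 2) ^ 3

variable {δ : ℝ}

lemma add_sum_sq_pos (hδ : 0 < δ) (u : K → ℝ) : 0 < δ + ∑ k, u k ^ 2 :=
  add_pos_of_pos_of_nonneg hδ (Finset.sum_nonneg fun _ _ => sq_nonneg _)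

lemma contDiff_smoothNorm (hδ : 0 < δ) : ContDiff ℝ 2 (smoothNorm (K := K) δ) := by
  unfold smoothNorm
  refine ContDiff.add (ContDiff.sqrt ?_ fun p => (add_sum_sq_pos hδ p.1).ne') contDiff_snd
  refine contDiff_const.add (ContDiff.sum fun k _ => ContDiff.pow ?_ 2)
  exact (contDiff_apply ℝ ℝ k).comp contDiff_fst

lemma hasDerivAt_sum_sq_line (δ : ℝ) (u v : K → ℝ) (s : ℝ) :
    HasDerivAt (fun t => δ + ∑ k, (u k + t * v k) ^ 2)
      (2 * ∑ k, (u k + s * v k) * v k) s := by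
  have : HasDerivAt (fun t => ∑ k, (u k + t * v k) ^ 2)
      (∑ k, (2 : ℕ) * (u k + s * v k) ^ (2 - 1) * (1 * v k)) s :=
    HasDerivAt.fun_sum fun k _ =>
      (((hasDerivAt_id s).mul_const (v k)).const_add (u k)).pow 2
  refine (this.const_add δ).congr_deriv ?_
  rw [Finset.mul_sum]
  exact Finset.sum_congr rfl fun k _ => by push_cast; ring

lemma hasDerivAt_sqrt_sum_sq_line (hδ : 0 < δ) (u v : K → ℝ) (s : ℝ) :
    HasDerivAt (fun t => √(δ + ∑ k, (u k + t * v k) ^ 2))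
      ((∑ k, (u k + s * v k) * v k) / √(δ + ∑ k, (u k + s * v k) ^ 2)) s := by
  refine ((hasDerivAt_sum_sq_line δ u v s).sqrt
    (add_sum_sq_pos hδ fun k => u k + s * v k).ne').congr_deriv ?_
  rw [mul_div_mul_left _ _ two_ne_zero]

lemma hasDerivAt_smoothNorm_line (hδ : 0 < δ) (p q : (K → ℝ) × ℝ) (s : ℝ) :
    HasDerivAt (fun t : ℝ => smoothNorm δ (p + t • q)) (smoothNormDeriv δ (p + s • q) q) s := by
  simp only [smoothNorm, smoothNormDeriv, Prod.fst_add, Prod.smul_fst, Pi.add_apply,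
    Pi.smul_apply, smul_eq_mul, Prod.snd_add, Prod.smul_snd]
  refine (hasDerivAt_sqrt_sum_sq_line hδ p.1 q.1 s).add ?_
  simpa using ((hasDerivAt_id s).mul_const q.2).const_add p.2

lemma hasDerivAt_smoothNormDeriv_line (hδ : 0 < δ) (p q : (K → ℝ) × ℝ) :
    HasDerivAt (fun t : ℝ => smoothNormDeriv δ (p + t • q) q) (smoothNormDeriv₂ δ p q) 0 := by
  simp only [smoothNormDeriv, smoothNormDeriv₂, Prod.fst_add, Prod.smul_fst, Pi.add_apply,
    Pi.smul_apply, smul_eq_mul]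
  have h1 : HasDerivAt (fun t => ∑ k, (p.1 k + t * q.1 k) * q.1 k)
      (∑ k, (1 * q.1 k) * q.1 k) 0 :=
    HasDerivAt.fun_sum fun k _ =>
      (((hasDerivAt_id (0 : ℝ)).mul_const (q.1 k)).const_add (p.1 k)).mul_const _
  have hR : √(δ + ∑ k, (p.1 k) ^ 2) ≠ 0 := (Real.sqrt_pos.2 (add_sum_sq_pos hδ p.1)).ne'
  have h2 := (h1.div (hasDerivAt_sqrt_sum_sq_line hδ p.1 q.1 0)
    (by simpa using hR)).add_const q.2
  refine h2.congr_deriv ?_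
  simp only [zero_mul, add_zero, one_mul, ← sq]
  field_simp

lemma abs_smoothNormDeriv_le (hδ : 0 < δ) (p q : (K → ℝ) × ℝ) :
    |smoothNormDeriv δ p q| ≤ (Fintype.card K + 1) * ‖q‖ := by
  have hR : 0 < √(δ + ∑ k, (p.1 k) ^ 2) := Real.sqrt_pos.2 (add_sum_sq_pos hδ p.1)
  have hk : ∀ k, |p.1 k| ≤ √(δ + ∑ k, (p.1 k) ^ 2) := fun k => by
    refine Real.abs_le_sqrt ?_
    have := Finset.single_le_sum (f := fun k => p.1 k ^ 2) (fun k _ => sq_nonneg (p.1 k))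
      (Finset.mem_univ k)
    linarith
  have hq : ∀ k, |q.1 k| ≤ ‖q‖ := fun k => (norm_le_pi_norm q.1 k).trans (norm_fst_le q)
  have h1 : |(∑ k, p.1 k * q.1 k) / √(δ + ∑ k, p.1 k ^ 2)| ≤ Fintype.card K * ‖q‖ := by
    rw [abs_div, abs_of_pos hR, div_le_iff₀ hR]
    calc |∑ k, p.1 k * q.1 k| ≤ ∑ k, |p.1 k * q.1 k| := Finset.abs_sum_le_sum_abs _ _
      _ ≤ ∑ _k : K, √(δ + ∑ k, p.1 k ^ 2) * ‖q‖ := Finset.sum_le_sum fun k _ => by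
          rw [abs_mul]; exact mul_le_mul (hk k) (hq k) (abs_nonneg _) hR.le
      _ = _ := by simp; ring
  have h2 : |q.2| ≤ ‖q‖ := norm_snd_le q
  calc |smoothNormDeriv δ p q| ≤ _ := abs_add_le _ _
    _ ≤ _ := by linarith

lemma abs_smoothNormDeriv₂_le (hδ : 0 < δ) (p q : (K → ℝ) × ℝ) :
    |smoothNormDeriv₂ δ p q| ≤
      ((∑ k, q.1 k ^ 2) + ((Fintype.card K + 1) * ‖q‖) ^ 2) / √δ := by
  have hR : 0 < √(δ + ∑ k, (p.1 k) ^ 2) := Real.sqrt_pos.2 (add_sum_sq_pos hδ p.1)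
  have hd : 0 < √δ := Real.sqrt_pos.2 hδ
  have hdR : √δ ≤ √(δ + ∑ k, (p.1 k) ^ 2) :=
    Real.sqrt_le_sqrt (le_add_of_nonneg_right (Finset.sum_nonneg fun _ _ => sq_nonneg _))
  have h1 := abs_smoothNormDeriv_le hδ p (q.1, 0)
  simp only [smoothNormDeriv, add_zero] at h1
  have hq : ‖(q.1, (0 : ℝ))‖ ≤ ‖q‖ := by
    rw [Prod.norm_def]; simpa using norm_fst_le q
  have h2 : ((∑ k, p.1 k * q.1 k) / √(δ + ∑ k, p.1 k ^ 2)) ^ 2 ≤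
      ((Fintype.card K + 1) * ‖q‖) ^ 2 := by
    rw [← sq_abs]
    exact pow_le_pow_left₀ (abs_nonneg _) (h1.trans (by gcongr)) 2
  have hS : 0 ≤ ∑ k, q.1 k ^ 2 := Finset.sum_nonneg fun _ _ => sq_nonneg _
  have e : smoothNormDeriv₂ δ p q = (∑ k, q.1 k ^ 2) / √(δ + ∑ k, p.1 k ^ 2) -
      ((∑ k, p.1 k * q.1 k) / √(δ + ∑ k, p.1 k ^ 2)) ^ 2 / √(δ + ∑ k, p.1 k ^ 2) := by
    rw [smoothNormDeriv₂]; field_simp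
  rw [e, add_div]
  refine (abs_sub _ _).trans (add_le_add ?_ ?_)
  · rw [abs_of_nonneg (by positivity)]
    gcongr
  · rw [abs_of_nonneg (by positivity)]
    gcongr

end SmoothNorm

section SoftMinNorm
variable {X K J : Type*} [Fintype X] [Nonempty X] [Fintype K]

/-- The smooth minimum of the smoothed norms. -/
noncomputable def softMinNorm (δ β : ℝ) (z : X → (K → ℝ) × ℝ) : ℝ :=
  softMin β fun x => smoothNorm δ (z x)

variable {δ β : ℝ}

lemma contDiff_softMinNorm (hδ : 0 < δ) :
    ContDiff ℝ 2 (softMinNorm δ β : (X → (K → ℝ) × ℝ) → ℝ) := by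
  unfold softMinNorm softMin
  refine contDiff_const.mul (ContDiff.log (ContDiff.sum fun x _ => ContDiff.exp
    (contDiff_const.mul ((contDiff_smoothNorm hδ).comp (contDiff_apply ℝ ((K → ℝ) × ℝ) x))))
    fun z => (sum_exp_pos β fun x => smoothNorm δ (z x)).ne')

lemma fderiv_softMinNorm (hδ : 0 < δ) (hβ : 0 < β) (z v : X → (K → ℝ) × ℝ) :
    fderiv ℝ (softMinNorm δ β) z v =
      ∑ x, gibbsWeight β (fun x => smoothNorm δ (z x)) x * smoothNormDeriv δ (z x) (v x) := by
  have hl : HasDerivAt (fun s : ℝ => z + s • v) v 0 := by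
    simpa using ((hasDerivAt_id (0 : ℝ)).smul_const v).const_add z
  have hd := ((contDiff_softMinNorm (X := X) (K := K) (β := β) hδ).differentiable (by norm_num)
    (z + (0 : ℝ) • v)).hasFDerivAt
  have h1 := hd.comp_hasDerivAt (0 : ℝ) hl
  have h2 : HasDerivAt (fun s : ℝ => softMinNorm δ β (z + s • v)) _ 0 :=
    hasDerivAt_softMin hβ fun x => hasDerivAt_smoothNorm_line hδ (z x) (v x) 0
  simpa using h1.unique h2

lemma fderiv_fderiv_softMinNorm (hδ : 0 < δ) (hβ : 0 < β) (z v : X → (K → ℝ) × ℝ) :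
    fderiv ℝ (fderiv ℝ (softMinNorm δ β)) z v v =
      ∑ x, gibbsWeight β (fun x => smoothNorm δ (z x)) x * smoothNormDeriv₂ δ (z x) (v x) -
      β * ∑ x, gibbsWeight β (fun x => smoothNorm δ (z x)) x *
        smoothNormDeriv δ (z x) (v x) ^ 2 +
      β * (∑ x, gibbsWeight β (fun x => smoothNorm δ (z x)) x *
        smoothNormDeriv δ (z x) (v x)) ^ 2 := by
  have h1 := hasDerivAt_fderiv_line (contDiff_softMinNorm (β := β) hδ) z v 0
  simp only [fderiv_softMinNorm hδ hβ] at h1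
  have h2 := hasDerivAt_sum_gibbsWeight_mul (β := β)
    (fun x => hasDerivAt_smoothNorm_line hδ (z x) (v x) 0)
    (fun x => hasDerivAt_smoothNormDeriv_line hδ (z x) (v x))
  simpa using h1.unique h2

lemma norm_fderiv_softMinNorm_le (hδ : 0 < δ) (hβ : 0 < β) (z : X → (K → ℝ) × ℝ) :
    ‖fderiv ℝ (softMinNorm δ β) z‖ ≤ Fintype.card K + 1 := by
  refine ContinuousLinearMap.opNorm_le_bound _ (by positivity) fun v => ?_
  rw [fderiv_softMinNorm hδ hβ]
  refine abs_sum_gibbsWeight_mul_le β _ fun x => (abs_smoothNormDeriv_le hδ _ _).trans ?_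
  gcongr
  exact norm_le_pi_norm v x

lemma exists_abs_fderiv_fderiv_softMinNorm_le (hδ : 0 < δ) (hβ : 0 < β)
    (v : X → (K → ℝ) × ℝ) :
    ∃ C, ∀ z, |fderiv ℝ (fderiv ℝ (softMinNorm δ β)) z v v| ≤ C := by
  obtain ⟨M, hM⟩ := Finite.exists_le fun x =>
    ((∑ k, (v x).1 k ^ 2) + ((Fintype.card K + 1) * ‖v x‖) ^ 2) / √δ
  set B : ℝ := (Fintype.card K + 1) * ‖v‖
  have hB : ∀ (z : X → (K → ℝ) × ℝ) x, |smoothNormDeriv δ (z x) (v x)| ≤ B := fun z x =>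
    (abs_smoothNormDeriv_le hδ _ _).trans
      (mul_le_mul_of_nonneg_left (norm_le_pi_norm v x) (by positivity))
  refine ⟨M + β * B ^ 2 + β * B ^ 2, fun z => ?_⟩
  rw [fderiv_fderiv_softMinNorm hδ hβ]
  have h1 := abs_sum_gibbsWeight_mul_le β (fun x => smoothNorm δ (z x))
    (fun x => (abs_smoothNormDeriv₂_le hδ (z x) (v x)).trans (hM x))
  have h2 := abs_sum_gibbsWeight_mul_le β (fun x => smoothNorm δ (z x))
    (r := fun x => smoothNormDeriv δ (z x) (v x) ^ 2) (M := B ^ 2)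
    (fun x => by rw [abs_pow]; exact pow_le_pow_left₀ (abs_nonneg _) (hB z x) 2)
  have h3 := abs_sum_gibbsWeight_mul_le β (fun x => smoothNorm δ (z x)) (hB z)
  have h4 := pow_le_pow_left₀ (abs_nonneg _) h3 2
  rw [sq_abs] at h4
  have h5 := mul_le_mul_of_nonneg_left h4 hβ.le
  have h6 := mul_le_mul_of_nonneg_left h2 hβ.le
  refine (abs_add_le _ _).trans (add_le_add ((abs_sub _ _).trans (add_le_add h1 ?_)) ?_)
  · rw [abs_mul, abs_of_pos hβ]; exact h6
  · rw [abs_of_nonneg (by positivity)]; exact h5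

lemma sum_fderiv_fderiv_softMinNorm {ι : Type*} [Fintype ι]
    (hδ : 0 < δ) (hβ : 0 < β) (v : ι → X → (K → ℝ) × ℝ) (z : X → (K → ℝ) × ℝ) :
    ∑ a, fderiv ℝ (fderiv ℝ (softMinNorm δ β)) z (v a) (v a) =
      ∑ x, gibbsWeight β (fun x => smoothNorm δ (z x)) x *
        ∑ a, smoothNormDeriv₂ δ (z x) (v a x) -
      β * ∑ x, gibbsWeight β (fun x => smoothNorm δ (z x)) x *
        ∑ a, smoothNormDeriv δ (z x) (v a x) ^ 2 +
      β * ∑ x, ∑ y, gibbsWeight β (fun x => smoothNorm δ (z x)) x *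
        gibbsWeight β (fun x => smoothNorm δ (z x)) y *
        ∑ a, smoothNormDeriv δ (z x) (v a x) * smoothNormDeriv δ (z y) (v a y) := by
  set p := gibbsWeight β (fun x => smoothNorm δ (z x))
  have hsq : ∀ f : X → ℝ, (∑ x, p x * f x) ^ 2 = ∑ x, ∑ y, p x * p y * (f x * f y) := by
    intro f
    rw [sq, Finset.sum_mul_sum]
    exact Finset.sum_congr rfl fun x _ => Finset.sum_congr rfl fun y _ => by ring
  simp only [fderiv_fderiv_softMinNorm hδ hβ, Finset.sum_add_distrib, Finset.sum_sub_distrib,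
    ← Finset.mul_sum]
  congr 1
  · congr 1
    · rw [Finset.sum_comm]; simp only [Finset.mul_sum, p]
    · congr 1
      rw [Finset.sum_comm]; simp only [Finset.mul_sum, p]
  · congr 1
    calc _ = ∑ a, ∑ x, ∑ y, p x * p y *
          (smoothNormDeriv δ (z x) (v a x) * smoothNormDeriv δ (z y) (v a y)) :=
          Finset.sum_congr rfl fun a _ => hsq _
      _ = _ := by
        rw [Finset.sum_comm]
        refine Finset.sum_congr rfl fun x _ => ?_
        rw [Finset.sum_comm]
        exact Finset.sum_congr rfl fun y _ => (Finset.mul_sum _ _ _).symm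

/-- Trace comparison for the smooth minimum from comparison of the derivative correlations. -/
lemma sum_fderiv_fderiv_softMinNorm_le {ι κ : Type*} [Fintype ι] [Fintype κ]
    (hδ : 0 < δ) (hβ : 0 < β) (v : ι → X → (K → ℝ) × ℝ) (u : κ → X → (K → ℝ) × ℝ)
    (z : X → (K → ℝ) × ℝ)
    (h₂ : ∀ x, ∑ b, smoothNormDeriv₂ δ (z x) (u b x) = ∑ a, smoothNormDeriv₂ δ (z x) (v a x))
    (h₁ : ∀ x, ∑ b, smoothNormDeriv δ (z x) (u b x) ^ 2 =
      ∑ a, smoothNormDeriv δ (z x) (v a x) ^ 2)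
    (h₁₁ : ∀ x y, ∑ b, smoothNormDeriv δ (z x) (u b x) * smoothNormDeriv δ (z y) (u b y) ≤
      ∑ a, smoothNormDeriv δ (z x) (v a x) * smoothNormDeriv δ (z y) (v a y)) :
    ∑ b, fderiv ℝ (fderiv ℝ (softMinNorm δ β)) z (u b) (u b) ≤
      ∑ a, fderiv ℝ (fderiv ℝ (softMinNorm δ β)) z (v a) (v a) := by
  rw [sum_fderiv_fderiv_softMinNorm hδ hβ, sum_fderiv_fderiv_softMinNorm hδ hβ]
  simp only [h₂, h₁]
  gcongr with x _ y _
  · exact mul_nonneg (gibbsWeight_nonneg _ _ _) (gibbsWeight_nonneg _ _ _)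
  · exact h₁₁ x y

end SoftMinNorm

/-- Restricting a standard Gaussian vector to a subfamily of its coordinates. -/
lemma measurePreserving_comp_stdGaussianPi {σ τ : Type*} [Fintype σ] [Fintype τ] {e : σ → τ}
    (he : Function.Injective e) :
    MeasurePreserving (fun (ξ : τ → ℝ) a => ξ (e a)) (stdGaussianPi τ) (stdGaussianPi σ) := by
  have hm : Measurable (fun (ξ : τ → ℝ) a => ξ (e a)) := by fun_prop
  refine ⟨hm, ?_⟩
  have h1 : iIndepFun (fun (i : τ) (ω : τ → ℝ) => ω i) (stdGaussianPi τ) :=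
    iIndepFun_pi (X := fun _ => id) fun _ => aemeasurable_id
  have h2 := h1.precomp he
  have h3 := (iIndepFun_iff_map_fun_eq_pi_map
    (fun i => (measurable_pi_apply (e i)).aemeasurable)).1 h2
  rw [show (fun (ξ : τ → ℝ) a => ξ (e a)) = fun ω i => ω (e i) from rfl]
  refine h3.trans ?_
  congr 1
  ext1 i
  exact (measurePreserving_eval (fun _ : τ => gaussianReal 0 1) (e i)).map_eq

section Gordon
variable {X K J : Type*} [Fintype K] [Fintype J]

/-- The coefficients of the bilinear Gaussian process. -/
noncomputable def bilinearCoeff [DecidableEq K] (w : X → J → ℝ) :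
    (K × J) ⊕ Unit → X → (K → ℝ) × ℝ
  | Sum.inl a, x => (Pi.single a.1 (w x a.2), 0)
  | Sum.inr _, x => (0, √(∑ j, w x j ^ 2))

/-- The coefficients of the decoupled Gaussian process. -/
noncomputable def decoupledCoeff [DecidableEq K] (w : X → J → ℝ) :
    K ⊕ J → X → (K → ℝ) × ℝ
  | Sum.inl k, x => (Pi.single k √(∑ j, w x j ^ 2), 0)
  | Sum.inr j, x => (0, -w x j)

lemma smoothNormDeriv_single [DecidableEq K] (δ : ℝ) (p : (K → ℝ) × ℝ) (k : K) (a : ℝ) :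
    smoothNormDeriv δ p (Pi.single k a, 0) = p.1 k / √(δ + ∑ k, p.1 k ^ 2) * a := by
  simp [smoothNormDeriv, Pi.single_apply]; ring

lemma smoothNormDeriv_zero_left (δ : ℝ) (p : (K → ℝ) × ℝ) (a : ℝ) :
    smoothNormDeriv δ p (0, a) = a := by
  simp [smoothNormDeriv]

lemma smoothNormDeriv₂_single [DecidableEq K] (δ : ℝ) (p : (K → ℝ) × ℝ) (k : K) (a : ℝ) :
    smoothNormDeriv₂ δ p (Pi.single k a, 0) =
      (1 / √(δ + ∑ k, p.1 k ^ 2) - p.1 k ^ 2 / √(δ + ∑ k, p.1 k ^ 2) ^ 3) * a ^ 2 := by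
  simp [smoothNormDeriv₂, Pi.single_apply, ite_pow]; ring

lemma smoothNormDeriv₂_zero_left (δ : ℝ) (p : (K → ℝ) × ℝ) (a : ℝ) :
    smoothNormDeriv₂ δ p (0, a) = 0 := by
  simp [smoothNormDeriv₂]

lemma sum_smoothNormDeriv₂_decoupledCoeff [DecidableEq K] (w : X → J → ℝ) (δ : ℝ)
    (p : (K → ℝ) × ℝ) (x : X) :
    ∑ b, smoothNormDeriv₂ δ p (decoupledCoeff w b x) =
      ∑ a, smoothNormDeriv₂ δ p (bilinearCoeff w a x) := by
  have hN : √(∑ j, w x j ^ 2) ^ 2 = ∑ j, w x j ^ 2 :=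
    Real.sq_sqrt (Finset.sum_nonneg fun _ _ => sq_nonneg _)
  simp only [Fintype.sum_sum_type, decoupledCoeff, bilinearCoeff, Fintype.sum_prod_type,
    smoothNormDeriv₂_zero_left, smoothNormDeriv₂_single, hN, Finset.mul_sum,
    Finset.sum_const_zero]

lemma sum_smoothNormDeriv_mul_decoupledCoeff [DecidableEq K] (w : X → J → ℝ) (δ : ℝ)
    (p q : (K → ℝ) × ℝ) (x y : X) :
    ∑ b, smoothNormDeriv δ p (decoupledCoeff w b x) * smoothNormDeriv δ q (decoupledCoeff w b y) =
      (∑ k, p.1 k / √(δ + ∑ k, p.1 k ^ 2) * (q.1 k / √(δ + ∑ k, q.1 k ^ 2))) *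
        (√(∑ j, w x j ^ 2) * √(∑ j, w y j ^ 2)) + ∑ j, w x j * w y j := by
  simp only [Fintype.sum_sum_type, decoupledCoeff, smoothNormDeriv_zero_left,
    smoothNormDeriv_single, neg_mul_neg, Finset.sum_mul]
  congr 1
  exact Finset.sum_congr rfl fun k _ => by ring

lemma sum_smoothNormDeriv_mul_bilinearCoeff [DecidableEq K] (w : X → J → ℝ) (δ : ℝ)
    (p q : (K → ℝ) × ℝ) (x y : X) :
    ∑ a, smoothNormDeriv δ p (bilinearCoeff w a x) * smoothNormDeriv δ q (bilinearCoeff w a y) =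
      (∑ k, p.1 k / √(δ + ∑ k, p.1 k ^ 2) * (q.1 k / √(δ + ∑ k, q.1 k ^ 2))) *
        (∑ j, w x j * w y j) + √(∑ j, w x j ^ 2) * √(∑ j, w y j ^ 2) := by
  simp only [Fintype.sum_sum_type, bilinearCoeff, smoothNormDeriv_zero_left,
    smoothNormDeriv_single, Finset.sum_mul_sum, Fintype.sum_prod_type]
  congr 1
  · exact Finset.sum_congr rfl fun k _ => Finset.sum_congr rfl fun j _ => by ring
  · simp

lemma sum_div_sqrt_mul_div_sqrt_le_one {δ : ℝ} (hδ : 0 < δ) (p q : K → ℝ) :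
    ∑ k, p k / √(δ + ∑ k, p k ^ 2) * (q k / √(δ + ∑ k, q k ^ 2)) ≤ 1 := by
  have hp := Real.sqrt_pos.2 (add_sum_sq_pos hδ p)
  have hq := Real.sqrt_pos.2 (add_sum_sq_pos hδ q)
  have e : ∑ k, p k / √(δ + ∑ k, p k ^ 2) * (q k / √(δ + ∑ k, q k ^ 2)) =
      (∑ k, p k * q k) / (√(δ + ∑ k, p k ^ 2) * √(δ + ∑ k, q k ^ 2)) := by
    rw [Finset.sum_div]
    exact Finset.sum_congr rfl fun k _ => by rw [div_mul_div_comm]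
  rw [e, div_le_one (mul_pos hp hq)]
  refine (Real.sum_mul_le_sqrt_mul_sqrt _ _ _).trans ?_
  gcongr <;> linarith

lemma sum_bilinearCoeff_smul [DecidableEq K] (w : X → J → ℝ) (ξ : (K × J) ⊕ Unit → ℝ) (x : X) :
    (∑ a, ξ a • bilinearCoeff w a) x =
      (fun k => ∑ j, ξ (Sum.inl (k, j)) * w x j, ξ (Sum.inr ()) * √(∑ j, w x j ^ 2)) := by
  rw [Finset.sum_apply]
  refine Prod.ext (funext fun k => ?_) ?_
  · rw [Prod.fst_sum, Finset.sum_apply]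
    simp [Fintype.sum_prod_type, bilinearCoeff, Pi.single_apply]
  · rw [Prod.snd_sum]
    simp [bilinearCoeff]

lemma sum_decoupledCoeff_smul [DecidableEq K] (w : X → J → ℝ) (ξ : K ⊕ J → ℝ) (x : X) :
    (∑ a, ξ a • decoupledCoeff w a) x =
      (fun k => ξ (Sum.inl k) * √(∑ j, w x j ^ 2), -∑ j, ξ (Sum.inr j) * w x j) := by
  rw [Finset.sum_apply]
  refine Prod.ext (funext fun k => ?_) ?_
  · rw [Prod.fst_sum, Finset.sum_apply]
    simp [decoupledCoeff, Pi.single_apply]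
  · rw [Prod.snd_sum]
    simp [decoupledCoeff]

variable [Fintype X]

lemma softMinNorm_bilinearCoeff_le [DecidableEq K] {δ β : ℝ} (hδ : 0 < δ) (hβ : 0 < β)
    (w : X → J → ℝ) (ξ : (K × J) ⊕ Unit → ℝ) (x : X) :
    softMinNorm δ β (∑ a, ξ a • bilinearCoeff w a) ≤
      √(∑ k, (∑ j, ξ (Sum.inl (k, j)) * w x j) ^ 2) +
        ξ (Sum.inr ()) * √(∑ j, w x j ^ 2) + √δ := by
  refine (softMin_le hβ _ x).trans ?_
  rw [sum_bilinearCoeff_smul, smoothNorm]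
  have : √(δ + ∑ k, (∑ j, ξ (Sum.inl (k, j)) * w x j) ^ 2) ≤
      √δ + √(∑ k, (∑ j, ξ (Sum.inl (k, j)) * w x j) ^ 2) := by
    rw [Real.sqrt_le_left (by positivity), add_sq, Real.sq_sqrt hδ.le,
      Real.sq_sqrt (Finset.sum_nonneg fun _ _ => sq_nonneg _)]
    have : 0 ≤ 2 * √δ * √(∑ k, (∑ j, ξ (Sum.inl (k, j)) * w x j) ^ 2) := by positivity
    linarith
  simp only
  linarith

variable [Nonempty X]

/-- Gordon's comparison inequality for a smooth minimum. -/
lemma integral_softMinNorm_decoupledCoeff_le [DecidableEq K] {δ β : ℝ} (hδ : 0 < δ) (hβ : 0 < β)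
    (w : X → J → ℝ) :
    ∫ ξ, softMinNorm δ β (∑ b, ξ b • decoupledCoeff w b) ∂stdGaussianPi (K ⊕ J) ≤
      ∫ ξ, softMinNorm δ β (∑ a, ξ a • bilinearCoeff w a) ∂stdGaussianPi ((K × J) ⊕ Unit) := by
  choose C hC using fun v => exists_abs_fderiv_fderiv_softMinNorm_le (X := X) (K := K) hδ hβ v
  obtain ⟨C₁, hC₁⟩ := Finite.exists_le fun a : (K × J) ⊕ Unit => C (bilinearCoeff w a)
  obtain ⟨C₂, hC₂⟩ := Finite.exists_le fun b : K ⊕ J => C (decoupledCoeff w b)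
  have key := integral_comp_sum_smul_le (F := softMinNorm (X := X) (K := K) δ β)
    (C' := max C₁ C₂) (contDiff_softMinNorm hδ) (norm_fderiv_softMinNorm_le hδ hβ)
    (bilinearCoeff w) (decoupledCoeff w)
    (fun a z => (hC _ z).trans ((hC₁ a).trans (le_max_left _ _)))
    (fun a z => (hC _ z).trans ((hC₂ a).trans (le_max_right _ _)))
    (fun z => sum_fderiv_fderiv_softMinNorm_le hδ hβ _ _ z
      (fun x => sum_smoothNormDeriv₂_decoupledCoeff w δ (z x) x)
      (fun x => by
        simp only [sq (smoothNormDeriv _ _ _)]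
        rw [sum_smoothNormDeriv_mul_decoupledCoeff, sum_smoothNormDeriv_mul_bilinearCoeff,
          Real.mul_self_sqrt (Finset.sum_nonneg fun _ _ => sq_nonneg _)]
        simp only [sq (w _ _)])
      (fun x y => by
        rw [sum_smoothNormDeriv_mul_decoupledCoeff, sum_smoothNormDeriv_mul_bilinearCoeff]
        have h1 := sum_div_sqrt_mul_div_sqrt_le_one hδ (z x).1 (z y).1
        have h2 := Real.sum_mul_le_sqrt_mul_sqrt Finset.univ (w x) (w y)
        nlinarith [mul_nonneg (sub_nonneg.2 h1) (sub_nonneg.2 h2)]))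
  have hc : Continuous (softMinNorm (X := X) (K := K) δ β) := (contDiff_softMinNorm hδ).continuous
  have m1 := measurePreserving_comp_stdGaussianPi
    (Sum.inr_injective : Function.Injective (Sum.inr : K ⊕ J → ((K × J) ⊕ Unit) ⊕ (K ⊕ J)))
  have m2 := measurePreserving_comp_stdGaussianPi
    (Sum.inl_injective : Function.Injective (Sum.inl : (K × J) ⊕ Unit → ((K × J) ⊕ Unit) ⊕ (K ⊕ J)))
  rw [← m1.map_eq, ← m2.map_eq, integral_map m1.measurable.aemeasurable,
    integral_map m2.measurable.aemeasurable]
  · exact key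
  · exact Continuous.aestronglyMeasurable (hc.comp (by fun_prop))
  · exact Continuous.aestronglyMeasurable (hc.comp (by fun_prop))

lemma integrable_softMinNorm_sum_smul {ι : Type*} [Fintype ι] {δ β : ℝ} (hδ : 0 < δ) (hβ : 0 < β)
    (v : ι → X → (K → ℝ) × ℝ) :
    Integrable (fun ξ => softMinNorm δ β (∑ a, ξ a • v a)) (stdGaussianPi ι) := by
  have hd : Differentiable ℝ (softMinNorm (X := X) (K := K) δ β) :=
    (contDiff_softMinNorm hδ).differentiable (by norm_num)
  have := integrable_comp_sum_smul hd (norm_fderiv_softMinNorm_le hδ hβ) (fun _ => 1)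
    (by simp) v
  simpa only [one_mul] using this

lemma sub_le_softMinNorm_decoupledCoeff [DecidableEq K] {δ β : ℝ} (hδ : 0 < δ) (hβ : 0 < β)
    (w : X → J → ℝ) (ξ : K ⊕ J → ℝ) {b : ℝ}
    (hb : ∀ x, b ≤ √(∑ j, w x j ^ 2) * √(∑ k, ξ (Sum.inl k) ^ 2) -
      ∑ j, ξ (Sum.inr j) * w x j) :
    b - Real.log (Fintype.card X) / β ≤ softMinNorm δ β (∑ b, ξ b • decoupledCoeff w b) := by
  refine sub_log_card_div_le_softMin hβ _ fun x => (hb x).trans ?_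
  rw [sum_decoupledCoeff_smul, smoothNorm]
  rw [sub_eq_add_neg, ← Real.sqrt_mul (Finset.sum_nonneg fun _ _ => sq_nonneg _)]
  gcongr
  simp only [mul_pow]
  rw [← Finset.sum_mul, Real.sq_sqrt (Finset.sum_nonneg fun _ _ => sq_nonneg _), mul_comm]
  exact le_add_of_nonneg_left hδ.le

/-- Gordon's comparison inequality. -/
theorem integral_le_integral_of_gordon (w : X → J → ℝ) {f : (K ⊕ J → ℝ) → ℝ}
    {g : ((K × J) ⊕ Unit → ℝ) → ℝ} (hf : Integrable f (stdGaussianPi (K ⊕ J)))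
    (hg : Integrable g (stdGaussianPi ((K × J) ⊕ Unit)))
    (hfw : ∀ ξ x, f ξ ≤ √(∑ j, w x j ^ 2) * √(∑ k, ξ (Sum.inl k) ^ 2) -
      ∑ j, ξ (Sum.inr j) * w x j)
    (hgw : ∀ ξ, ∃ x, √(∑ k, (∑ j, ξ (Sum.inl (k, j)) * w x j) ^ 2) +
      ξ (Sum.inr ()) * √(∑ j, w x j ^ 2) ≤ g ξ) :
    ∫ ξ, f ξ ∂stdGaussianPi (K ⊕ J) ≤ ∫ ξ, g ξ ∂stdGaussianPi ((K × J) ⊕ Unit) := by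
  classical
  have key : ∀ t : ℝ, 0 < t → ∫ ξ, f ξ ∂stdGaussianPi (K ⊕ J) ≤
      ∫ ξ, g ξ ∂stdGaussianPi ((K × J) ⊕ Unit) + (t + Real.log (Fintype.card X) * t) := by
    intro t ht
    have hδ : 0 < t ^ 2 := by positivity
    have hβ : 0 < t⁻¹ := by positivity
    have i1 := integrable_softMinNorm_sum_smul hδ hβ (decoupledCoeff (K := K) w)
    have i2 := integrable_softMinNorm_sum_smul hδ hβ (bilinearCoeff (K := K) w)
    have h1 := integral_mono (hf.sub (integrable_const _)) i1
      fun ξ => sub_le_softMinNorm_decoupledCoeff hδ hβ w ξ (hfw ξ)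
    have h2 := integral_mono i2 (hg.add (integrable_const t)) fun ξ => by
      obtain ⟨x, hx⟩ := hgw ξ
      have := softMinNorm_bilinearCoeff_le hδ hβ w ξ x
      rw [Real.sqrt_sq ht.le] at this
      exact this.trans (add_le_add_left hx t)
    rw [integral_sub' hf (integrable_const _), integral_const, div_inv_eq_mul] at h1
    rw [integral_add' hg (integrable_const _), integral_const] at h2
    simp only [probReal_univ, one_smul] at h1 h2
    linarith [integral_softMinNorm_decoupledCoeff_le (K := K) hδ hβ w]
  have hlim : Tendsto (fun t : ℝ => ∫ ξ, g ξ ∂stdGaussianPi ((K × J) ⊕ Unit) +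
      (t + Real.log (Fintype.card X) * t)) (nhdsWithin 0 (Set.Ioi 0))
      (nhds (∫ ξ, g ξ ∂stdGaussianPi ((K × J) ⊕ Unit) +
        (0 + Real.log (Fintype.card X) * 0))) :=
    (Continuous.tendsto (by fun_prop) 0).mono_left nhdsWithin_le_nhds
  have := ge_of_tendsto hlim (eventually_mem_nhdsWithin.mono fun t ht => key t ht)
  simpa using this

end Gordon

lemma sqrt_sum_add_sq_le {K : Type*} [Fintype K] (a b : K → ℝ) :
    √(∑ k, (a k + b k) ^ 2) ≤ √(∑ k, a k ^ 2) + ∑ k, |b k| := by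
  have h1 : √(∑ k, b k ^ 2) ≤ ∑ k, |b k| := by
    rw [Real.sqrt_le_left (Finset.sum_nonneg fun _ _ => abs_nonneg _)]
    calc ∑ k, b k ^ 2 = ∑ k, |b k| ^ 2 := by simp
      _ ≤ _ := Finset.sum_sq_le_sq_sum_of_nonneg fun _ _ => abs_nonneg _
  have h2 := norm_add_le (WithLp.toLp 2 a) (WithLp.toLp 2 b)
  simp only [EuclideanSpace.norm_eq, PiLp.add_apply, Real.norm_eq_abs, sq_abs] at h2
  linarith

section Compact
variable {K J : Type*} [Fintype K] [Fintype J]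

lemma continuous_sqrt_sum_sq :
    Continuous fun p : ((K × J) ⊕ Unit → ℝ) × (J → ℝ) =>
      √(∑ k, (∑ j, p.1 (Sum.inl (k, j)) * p.2 j) ^ 2) := by
  fun_prop

lemma integrable_sInf_sqrt_sum_sq {W : Set (J → ℝ)} (hW : IsCompact W) (hne : W.Nonempty) :
    Integrable (fun ξ : (K × J) ⊕ Unit → ℝ =>
      sInf ((fun w => √(∑ k, (∑ j, ξ (Sum.inl (k, j)) * w j) ^ 2)) '' W))
      (stdGaussianPi ((K × J) ⊕ Unit)) := by
  obtain ⟨w₀, hw₀⟩ := hne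
  have hi : Integrable (fun ξ : (K × J) ⊕ Unit → ℝ => ∑ k, ∑ j, |ξ (Sum.inl (k, j))| * |w₀ j|)
      (stdGaussianPi ((K × J) ⊕ Unit)) :=
    integrable_finsetSum _ fun k _ => integrable_finsetSum _ fun j _ =>
      (integrable_eval_stdGaussianPi _).abs.mul_const _
  refine hi.mono' (IsCompact.continuous_sInf hW continuous_sqrt_sum_sq).aestronglyMeasurable
    (ae_of_all _ fun ξ => ?_)
  have hbdd : BddBelow ((fun w => √(∑ k, (∑ j, ξ (Sum.inl (k, j)) * w j) ^ 2)) '' W) :=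
    ⟨0, by rintro _ ⟨w, _, rfl⟩; positivity⟩
  rw [Real.norm_eq_abs, abs_of_nonneg (Real.sInf_nonneg (by rintro _ ⟨w, _, rfl⟩; positivity))]
  refine (csInf_le hbdd ⟨w₀, hw₀, rfl⟩).trans ?_
  have := sqrt_sum_add_sq_le (fun _ : K => 0) fun k => ∑ j, ξ (Sum.inl (k, j)) * w₀ j
  simp only [zero_add, ne_eq, OfNat.ofNat_ne_zero, not_false_eq_true, zero_pow,
    Finset.sum_const_zero, Real.sqrt_zero] at this
  refine this.trans (Finset.sum_le_sum fun k _ => (Finset.abs_sum_le_sum_abs _ _).trans ?_)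
  simp only [abs_mul, le_refl]

/-- Gordon's comparison inequality over a compact index set. -/
theorem integral_le_integral_sInf_of_gordon {W : Set (J → ℝ)} (hW : IsCompact W)
    (hne : W.Nonempty) {C : ℝ} (hC : ∀ w ∈ W, √(∑ j, w j ^ 2) ≤ C)
    {f : (K ⊕ J → ℝ) → ℝ} (hf : Integrable f (stdGaussianPi (K ⊕ J)))
    (hfw : ∀ ξ, ∀ w ∈ W, f ξ ≤ √(∑ j, w j ^ 2) * √(∑ k, ξ (Sum.inl k) ^ 2) -
      ∑ j, ξ (Sum.inr j) * w j) :
    ∫ ξ, f ξ ∂stdGaussianPi (K ⊕ J) ≤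
      (∫ ξ, sInf ((fun w => √(∑ k, (∑ j, ξ (Sum.inl (k, j)) * w j) ^ 2)) '' W)
        ∂stdGaussianPi ((K × J) ⊕ Unit)) + ∫ ξ, |ξ (Sum.inr ())| * C
        ∂stdGaussianPi ((K × J) ⊕ Unit) := by
  have hi1 := integrable_sInf_sqrt_sum_sq (K := K) hW hne
  have hi2 : Integrable (fun ξ => |ξ (Sum.inr ())| * C) (stdGaussianPi ((K × J) ⊕ Unit)) :=
    (integrable_eval_stdGaussianPi _).abs.mul_const _
  have hi3 : Integrable (fun ξ : (K × J) ⊕ Unit → ℝ => ∑ k, ∑ j, |ξ (Sum.inl (k, j))|)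
      (stdGaussianPi ((K × J) ⊕ Unit)) :=
    integrable_finsetSum _ fun k _ => integrable_finsetSum _ fun j _ =>
      (integrable_eval_stdGaussianPi _).abs
  set D := ∫ ξ, (∑ k, ∑ j, |ξ (Sum.inl (k, j))|) ∂stdGaussianPi ((K × J) ⊕ Unit)
  set R := (∫ ξ, sInf ((fun w => √(∑ k, (∑ j, ξ (Sum.inl (k, j)) * w j) ^ 2)) '' W)
        ∂stdGaussianPi ((K × J) ⊕ Unit)) + ∫ ξ, |ξ (Sum.inr ())| * C
        ∂stdGaussianPi ((K × J) ⊕ Unit)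
  have key : ∀ ε : ℝ, 0 < ε → ∫ ξ, f ξ ∂stdGaussianPi (K ⊕ J) ≤ R + D * ε := by
    intro ε hε
    obtain ⟨X, hXW, hXf, hX⟩ := Metric.finite_approx_of_totallyBounded hW.totallyBounded ε hε
    have := hXf.fintype
    have hXne : Nonempty X := by
      obtain ⟨w, hw⟩ := hne
      obtain ⟨x, hx, -⟩ := Set.mem_iUnion₂.1 (hX hw)
      exact ⟨⟨x, hx⟩⟩
    have h := integral_le_integral_of_gordon (X := X) (fun x => x.1) (f := f)
      (g := fun ξ => sInf ((fun w => √(∑ k, (∑ j, ξ (Sum.inl (k, j)) * w j) ^ 2)) '' W) +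
        |ξ (Sum.inr ())| * C + (∑ k, ∑ j, |ξ (Sum.inl (k, j))|) * ε) hf
      ((hi1.add hi2).add (hi3.mul_const ε)) (fun ξ x => hfw ξ x.1 (hXW x.2)) fun ξ => by
        obtain ⟨w, hw, hwm⟩ := (hW.image (f := fun w =>
          √(∑ k, (∑ j, ξ (Sum.inl (k, j)) * w j) ^ 2)) (by fun_prop)).sInf_mem (hne.image _)
        obtain ⟨x, hx, hxw⟩ := Set.mem_iUnion₂.1 (hX hw)
        refine ⟨⟨x, hx⟩, ?_⟩
        rw [← hwm]
        have h1 := sqrt_sum_add_sq_le (fun k => ∑ j, ξ (Sum.inl (k, j)) * w j)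
          fun k => ∑ j, ξ (Sum.inl (k, j)) * (x j - w j)
        simp only [← Finset.sum_add_distrib, ← mul_add, add_sub_cancel] at h1
        have h2 : ∑ k, |∑ j, ξ (Sum.inl (k, j)) * (x j - w j)| ≤
            (∑ k, ∑ j, |ξ (Sum.inl (k, j))|) * ε := by
          rw [Finset.sum_mul]
          refine Finset.sum_le_sum fun k _ => (Finset.abs_sum_le_sum_abs _ _).trans ?_
          rw [Finset.sum_mul]
          refine Finset.sum_le_sum fun j _ => ?_
          rw [abs_mul]
          gcongr
          rw [← Real.dist_eq, dist_comm]
          exact (dist_le_pi_dist w x j).trans (Metric.mem_ball.1 hxw).le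
        have h3 : ξ (Sum.inr ()) * √(∑ j, x j ^ 2) ≤ |ξ (Sum.inr ())| * C :=
          mul_le_mul (le_abs_self _) (hC x (hXW hx)) (by positivity) (abs_nonneg _)
        linarith
    refine h.trans_eq ?_
    refine (integral_add (hi1.add hi2) (hi3.mul_const ε)).trans ?_
    rw [integral_add' hi1 hi2]
    congr 1
    exact integral_mul_const _ _
  have hlim : Tendsto (fun ε : ℝ => R + D * ε) (nhdsWithin 0 (Set.Ioi 0)) (nhds (R + D * 0)) :=
    (Continuous.tendsto (by fun_prop) 0).mono_left nhdsWithin_le_nhds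
  simpa using ge_of_tendsto hlim (eventually_mem_nhdsWithin.mono fun t ht => key t ht)

end Compact

lemma integral_sq_gaussianReal : ∫ x, x ^ 2 ∂gaussianReal 0 1 = 1 := by
  have := variance_fun_id_gaussianReal (μ := 0) (v := 1)
  rw [variance_of_integral_eq_zero (by fun_prop) (by simp)] at this
  simpa using this

lemma integral_abs_eval_stdGaussianPi_le {τ : Type*} [Fintype τ] (a : τ) :
    ∫ ξ, |ξ a| ∂stdGaussianPi τ ≤ 1 := by
  have hm := measurePreserving_eval (fun _ : τ => gaussianReal 0 1) a
  have h1 : ∫ ξ, |ξ a| ∂stdGaussianPi τ = ∫ x, |x| ∂gaussianReal 0 1 := by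
    rw [← hm.map_eq, integral_map hm.measurable.aemeasurable
      continuous_abs.aestronglyMeasurable]
  have h2 := integral_sq_gaussianReal
  have h3 : ∫ x, |x| ∂gaussianReal 0 1 ≤ ∫ x, (x ^ 2 + 1) / 2 ∂gaussianReal 0 1 :=
    integral_mono integrable_id_gaussianReal.abs
      ((integrable_sq_gaussianReal.add (integrable_const 1)).div_const 2) fun x => by
        simp only
        nlinarith [sq_nonneg (|x| - 1), sq_abs x]
  rw [integral_div, integral_add integrable_sq_gaussianReal (integrable_const 1), h2] at h3
  rw [h1]
  simpa using h3

/-- A standard Gaussian matrix and vector as coordinates of a standard Gaussian vector. -/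
lemma measurePreserving_matrix_vector (m n : ℕ) :
    MeasurePreserving
      (fun (ξ : (Fin m × (Fin n ⊕ Unit)) ⊕ Unit → ℝ) =>
        ((fun i j => ξ (Sum.inl (i, Sum.inl j)), fun i => ξ (Sum.inl (i, Sum.inr ()))) :
          (Fin m → Fin n → ℝ) × (Fin m → ℝ)))
      (stdGaussianPi ((Fin m × (Fin n ⊕ Unit)) ⊕ Unit))
      ((Measure.pi fun _ => Measure.pi fun _ => gaussianReal 0 1).prod
            (Measure.pi fun _ => gaussianReal 0 1)) := by
  let e : (Fin m × Fin n) ⊕ Fin m → (Fin m × (Fin n ⊕ Unit)) ⊕ Unit :=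
    Sum.elim (fun a => Sum.inl (a.1, Sum.inl a.2)) fun i => Sum.inl (i, Sum.inr ())
  have he : Function.Injective e := by
    rintro (⟨a, b⟩ | a) (⟨c, d⟩ | c) h <;> simp_all [e]
  have h1 := measurePreserving_comp_stdGaussianPi he
  have h2 := measurePreserving_sumPiEquivProdPi
    (fun _ : (Fin m × Fin n) ⊕ Fin m => gaussianReal 0 1)
  have h3 : MeasurePreserving (fun (ξ : Fin m × Fin n → ℝ) i j => ξ (i, j))
      (Measure.pi fun _ => gaussianReal 0 1)
      (Measure.pi fun _ => Measure.pi fun _ => gaussianReal 0 1) := by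
    refine ⟨by fun_prop, ?_⟩
    have := Measure.infinitePi_map_curry (fun (_ : Fin m) (_ : Fin n) => gaussianReal 0 1)
    simp only [Measure.infinitePi_eq_pi] at this
    exact this
  exact (h3.prod (MeasurePreserving.id _)).comp (h2.comp h1)

/-- Gordon's comparison inequality for the distance from an affine Gaussian image. -/
theorem integral_le_integral_sInf_add {m n : ℕ} {T : Set (Fin n → ℝ)} (hT : IsCompact T)
    (hne : T.Nonempty) (x₀ : Fin n → ℝ) (σ : ℝ) {C : ℝ}
    (hC : ∀ x ∈ T, √(∑ j, (x₀ j - x j) ^ 2 + σ ^ 2) ≤ C)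
    {f : (Fin m ⊕ (Fin n ⊕ Unit) → ℝ) → ℝ}
    (hf : Integrable f (stdGaussianPi (Fin m ⊕ (Fin n ⊕ Unit))))
    (hfw : ∀ ξ, ∀ x ∈ T, f ξ ≤ √(∑ j, (x₀ j - x j) ^ 2 + σ ^ 2) * √(∑ k, ξ (Sum.inl k) ^ 2) -
      (∑ j, ξ (Sum.inr (Sum.inl j)) * (x₀ j - x j) + ξ (Sum.inr (Sum.inr ())) * σ)) :
    ∫ ξ, f ξ ∂stdGaussianPi (Fin m ⊕ (Fin n ⊕ Unit)) ≤
      (∫ p : (Fin m → Fin n → ℝ) × (Fin m → ℝ),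
        sInf ((fun x => √(∑ i, (∑ j, p.1 i j * (x₀ j - x j) + σ * p.2 i) ^ 2)) '' T)
        ∂((Measure.pi fun _ => Measure.pi fun _ => gaussianReal 0 1).prod
            (Measure.pi fun _ => gaussianReal 0 1))) + C := by
  let Ψ : (Fin n → ℝ) → (Fin n ⊕ Unit → ℝ) := fun x => Sum.elim (fun j => x₀ j - x j) fun _ => σ
  have hΨ : Continuous Ψ := continuous_pi fun j => by
    rcases j with j | j
    · exact continuous_const.sub (continuous_apply j)
    · exact continuous_const
  have hC0 : 0 ≤ C := by
    obtain ⟨x, hx⟩ := hne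
    exact (Real.sqrt_nonneg _).trans (hC x hx)
  have h := integral_le_integral_sInf_of_gordon (K := Fin m) (hT.image hΨ) (hne.image Ψ) (C := C)
    (by rintro _ ⟨x, hx, rfl⟩; simpa [Ψ] using hC x hx) hf
    (by rintro ξ _ ⟨x, hx, rfl⟩; simpa [Ψ] using hfw ξ x hx)
  have hM := measurePreserving_matrix_vector m n
  have hcont : Continuous fun p : (Fin m → Fin n → ℝ) × (Fin m → ℝ) =>
      sInf ((fun x => √(∑ i, (∑ j, p.1 i j * (x₀ j - x j) + σ * p.2 i) ^ 2)) '' T) :=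
    IsCompact.continuous_sInf hT (by fun_prop)
  rw [integral_mul_const] at h
  rw [← hM.map_eq, integral_map hM.measurable.aemeasurable hcont.aestronglyMeasurable]
  refine h.trans (add_le_add (le_of_eq ?_) ?_)
  · congr 1
    ext ξ
    rw [Set.image_image]
    simp [Ψ, mul_comm σ]
  · have := integral_abs_eval_stdGaussianPi_le (Sum.inr () : (Fin m × (Fin n ⊕ Unit)) ⊕ Unit)
    exact mul_le_of_le_one_left hC0 this

section BoxMin

lemma erf_neg (x : ℝ) : erf (-x) = -erf x := by
  have h := intervalIntegral.integral_comp_neg (a := 0) (b := x) fun t => rexp (-t ^ 2)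
  simp only [neg_sq, neg_zero] at h
  rw [erf, erf, h, intervalIntegral.integral_symm]
  ring

lemma hasDerivAt_erf_div_sqrt_two (x : ℝ) :
    HasDerivAt (fun y => erf (y / √2) / 2) (gaussianPDFReal 0 1 x) x := by
  have hc : Continuous fun t : ℝ => rexp (-t ^ 2) := by fun_prop
  have h1 := ((hc.integral_hasStrictDerivAt 0 (x / √2)).hasDerivAt.comp x
    ((hasDerivAt_id x).div_const √2)).const_mul (2 / √π)
  refine (h1.div_const 2).congr_deriv ?_
  rw [gaussianPDFReal_zero_one, div_pow, Real.sq_sqrt zero_le_two, Real.sqrt_mul zero_le_two,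
    neg_div]
  field_simp

lemma tendsto_erf_atTop : Tendsto erf atTop (nhds 1) := by
  have hi : IntegrableOn (fun t : ℝ => rexp (-t ^ 2)) (Set.Ioi 0) := by
    simpa using (integrable_exp_neg_mul_sq (b := 1) one_pos).integrableOn
  have h := (intervalIntegral_tendsto_integral_Ioi 0 hi tendsto_id).const_mul (2 / √π)
  have h2 := integral_gaussian_Ioi 1
  simp only [neg_mul, one_mul, div_one] at h2
  have hπ : √π ≠ 0 := (Real.sqrt_pos.2 pi_pos).ne'
  rw [h2, show 2 / √π * (√π / 2) = 1 by field_simp] at h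
  exact h

lemma tendsto_erf_div_sqrt_two_atTop :
    Tendsto (fun x => erf (x / √2) / 2) atTop (nhds (1 / 2)) :=
  (tendsto_erf_atTop.comp (tendsto_id.atTop_div_const (by positivity))).div_const 2

lemma tendsto_erf_div_sqrt_two_atBot :
    Tendsto (fun x => erf (x / √2) / 2) atBot (nhds (-(1 / 2))) := by
  have h := (tendsto_erf_div_sqrt_two_atTop.comp tendsto_neg_atBot_atTop).neg
  simpa [Function.comp_def, neg_div, erf_neg] using h

lemma tendsto_gaussianPDFReal_atTop : Tendsto (gaussianPDFReal 0 1) atTop (nhds 0) := by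
  have h : Tendsto (fun x : ℝ => (√(2 * π))⁻¹ * rexp (-(x ^ 2 / 2))) atTop
      (nhds ((√(2 * π))⁻¹ * 0)) :=
    (tendsto_exp_neg_atTop_nhds_zero.comp
      ((tendsto_pow_atTop two_ne_zero).atTop_div_const zero_lt_two)).const_mul _
  simpa only [← neg_div, ← gaussianPDFReal_zero_one, mul_zero] using h

lemma tendsto_gaussianPDFReal_atBot : Tendsto (gaussianPDFReal 0 1) atBot (nhds 0) := by
  have h := tendsto_gaussianPDFReal_atTop.comp tendsto_neg_atBot_atTop
  refine h.congr fun x => ?_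
  simp [gaussianPDFReal_zero_one]

lemma hasDerivAt_gaussian_quadratic_primitive (p q r x : ℝ) :
    HasDerivAt (fun y => (p + r) * (erf (y / √2) / 2) - (q + r * y) * gaussianPDFReal 0 1 y)
      (gaussianPDFReal 0 1 x * (p + q * x + r * x ^ 2)) x := by
  have h1 := (hasDerivAt_erf_div_sqrt_two x).const_mul (p + r)
  have h2 := (((hasDerivAt_id x).const_mul r).const_add q).mul (hasDerivAt_gaussianPDFReal x)
  refine (h1.sub h2).congr_deriv ?_
  simp only [id]
  ring

lemma integrable_gaussianPDFReal_mul_quadratic (p q r : ℝ) :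
    Integrable fun x => gaussianPDFReal 0 1 x * (p + q * x + r * x ^ 2) := by
  rw [← integrable_gaussianReal_iff]
  exact ((integrable_const p).add (integrable_id_gaussianReal.const_mul q)).add
    (integrable_sq_gaussianReal.const_mul r)

lemma setIntegral_Ioi_gaussianPDFReal_mul_affine (p q b : ℝ) :
    ∫ x in Set.Ioi b, gaussianPDFReal 0 1 x * (p + q * x) =
      p * (1 - erf (b / √2)) / 2 + q * gaussianPDFReal 0 1 b := by
  have h := integral_Ioi_of_hasDerivAt_of_tendsto' (a := b)
    (fun x _ => hasDerivAt_gaussian_quadratic_primitive p q 0 x)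
    (integrable_gaussianPDFReal_mul_quadratic p q 0).integrableOn
    (m := p * (1 / 2) - q * 0)
    (by simpa using (tendsto_erf_div_sqrt_two_atTop.const_mul p).sub
          (tendsto_gaussianPDFReal_atTop.const_mul q))
  simp only [zero_mul, add_zero] at h
  rw [h]; ring

lemma setIntegral_Iic_gaussianPDFReal_mul_affine (p q a : ℝ) :
    ∫ x in Set.Iic a, gaussianPDFReal 0 1 x * (p + q * x) =
      p * (1 + erf (a / √2)) / 2 - q * gaussianPDFReal 0 1 a := by
  have h := integral_Iic_of_hasDerivAt_of_tendsto' (a := a)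
    (fun x _ => hasDerivAt_gaussian_quadratic_primitive p q 0 x)
    (integrable_gaussianPDFReal_mul_quadratic p q 0).integrableOn
    (m := p * (-(1 / 2)) - q * 0)
    (by simpa using (tendsto_erf_div_sqrt_two_atBot.const_mul p).sub
          (tendsto_gaussianPDFReal_atBot.const_mul q))
  simp only [zero_mul, add_zero] at h
  rw [h]; ring

/-- The minimum of `(h + ν) t + γ t²` over `|t| ≤ 1`, for `0 < γ`. -/
noncomputable def boxMin (γ ν h : ℝ) : ℝ :=
  if |h + ν| ≤ 2 * γ then -(h + ν) ^ 2 / (4 * γ) else γ - |h + ν|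

variable {γ : ℝ} (ν : ℝ)

lemma boxMin_le (hγ : 0 < γ) (h : ℝ) {t : ℝ} (ht : |t| ≤ 1) :
    boxMin γ ν h ≤ (h + ν) * t + γ * t ^ 2 := by
  unfold boxMin
  split_ifs with hu
  · rw [div_le_iff₀ (by positivity)]
    nlinarith [sq_nonneg (2 * γ * t + (h + ν))]
  · have h1 : -(|h + ν| * |t|) ≤ (h + ν) * t := by rw [← abs_mul]; exact neg_abs_le _
    have h2 : t ^ 2 = |t| ^ 2 := (sq_abs t).symm
    push Not at hu
    rw [h2]
    nlinarith [mul_nonneg (sub_nonneg.2 ht) (sub_nonneg.2 hu.le), abs_nonneg t,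
      mul_nonneg hγ.le (sq_nonneg (1 - |t|))]

lemma abs_boxMin_le (hγ : 0 < γ) (h : ℝ) : |boxMin γ ν h| ≤ |h| + |ν| := by
  have h0 := boxMin_le ν hγ h (t := 0) (by simp)
  have h1 : -|h + ν| ≤ boxMin γ ν h := by
    unfold boxMin
    split_ifs with hu
    · rw [le_div_iff₀ (by positivity)]
      nlinarith [sq_abs (h + ν), abs_nonneg (h + ν),
        mul_nonneg (sub_nonneg.2 hu) (abs_nonneg (h + ν)), mul_nonneg hγ.le (abs_nonneg (h + ν))]
    · linarith
  rw [abs_le]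
  constructor
  · linarith [abs_add_le h ν]
  · simp at h0; linarith [abs_nonneg h, abs_nonneg ν]

lemma measurable_boxMin : Measurable (boxMin γ ν) := by
  unfold boxMin
  exact Measurable.ite (measurableSet_le (by fun_prop) measurable_const) (by fun_prop)
    (by fun_prop)

lemma memLp_boxMin (hγ : 0 < γ) : MemLp (boxMin γ ν) 2 (gaussianReal 0 1) := by
  have h1 : MemLp (fun h : ℝ => |h| + |ν|) 2 (gaussianReal 0 1) :=
    (memLp_id_gaussianReal 2).abs.add (memLp_const _)
  refine h1.mono' (measurable_boxMin ν).aestronglyMeasurable (ae_of_all _ fun h => ?_)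
  exact abs_boxMin_le ν hγ h

lemma integral_boxMin (hγ : 0 < γ) :
    ∫ h, boxMin γ ν h ∂gaussianReal 0 1 = I22 γ ν - I1 γ ν + I21 γ ν := by
  have hint : Integrable fun x => gaussianPDFReal 0 1 x * boxMin γ ν x :=
    integrable_gaussianReal_iff.1 ((memLp_boxMin ν hγ).integrable one_le_two)
  set a := -(ν + 2 * γ) with ha
  set b := 2 * γ - ν with hb
  have hab : a ≤ b := by rw [ha, hb]; linarith
  rw [integral_gaussianReal_eq, ← intervalIntegral.integral_Iic_add_Ioi (b := a)
    hint.integrableOn hint.integrableOn, ← intervalIntegral.integral_interval_add_Ioi (b := b)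
    hint.integrableOn hint.integrableOn]
  have e1 : ∫ x in Set.Iic a, gaussianPDFReal 0 1 x * boxMin γ ν x =
      ∫ x in Set.Iic a, gaussianPDFReal 0 1 x * ((γ + ν) + 1 * x) := by
    refine setIntegral_congr_fun measurableSet_Iic fun x hx => ?_
    have hx' : x + ν ≤ -(2 * γ) := by have := Set.mem_Iic.1 hx; rw [ha] at this; linarith
    simp only [boxMin, abs_of_nonpos (show x + ν ≤ 0 by linarith)]
    split_ifs with hu
    · have : x = -(2 * γ) - ν := by linarith
      rw [this]; field_simp; ring
    · ring
  have e2 : ∫ x in Set.Ioi b, gaussianPDFReal 0 1 x * boxMin γ ν x =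
      ∫ x in Set.Ioi b, gaussianPDFReal 0 1 x * ((γ - ν) + (-1) * x) := by
    refine setIntegral_congr_fun measurableSet_Ioi fun x hx => ?_
    have hx' : 2 * γ < x + ν := by have := Set.mem_Ioi.1 hx; rw [hb] at this; linarith
    simp only [boxMin, abs_of_nonneg (show 0 ≤ x + ν by linarith)]
    rw [if_neg (by linarith)]
    ring
  have e3 : ∫ x in a..b, gaussianPDFReal 0 1 x * boxMin γ ν x =
      ∫ x in a..b, gaussianPDFReal 0 1 x *
        (-ν ^ 2 / (4 * γ) + (-(2 * ν) / (4 * γ)) * x + (-1 / (4 * γ)) * x ^ 2) := by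
    refine intervalIntegral.integral_congr fun x hx => ?_
    rw [Set.uIcc_of_le hab] at hx
    have hx' : |x + ν| ≤ 2 * γ :=
      abs_le.2 ⟨by linarith [hx.1], by linarith [hx.2]⟩
    simp only [boxMin, if_pos hx']
    field_simp
    ring
  rw [e1, e2, e3, setIntegral_Ioi_gaussianPDFReal_mul_affine,
    setIntegral_Iic_gaussianPDFReal_mul_affine,
    intervalIntegral.integral_eq_sub_of_hasDerivAt
      (fun x _ => hasDerivAt_gaussian_quadratic_primitive _ _ _ x)
      (integrable_gaussianPDFReal_mul_quadratic _ _ _).intervalIntegrable]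
  have ga : gaussianPDFReal 0 1 a = rexp (-(ν + 2 * γ) ^ 2 / 2) / √(2 * π) := by
    rw [gaussianPDFReal_zero_one, ha, neg_sq]; ring
  have gb : gaussianPDFReal 0 1 b = rexp (-(ν - 2 * γ) ^ 2 / 2) / √(2 * π) := by
    rw [gaussianPDFReal_zero_one, hb, ← neg_sub, neg_sq]; ring
  have s1 : √(π / 2) = √(2 * π) / 2 := by
    rw [show π / 2 = 2 * π / 2 ^ 2 by ring, Real.sqrt_div (by positivity),
      Real.sqrt_sq zero_le_two]
  have n1 : erf (a / √2) = -erf ((ν + 2 * γ) / √2) := by rw [ha, neg_div, erf_neg]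
  have n2 : erf ((ν - 2 * γ) / √2) = -erf (b / √2) := by
    rw [hb, ← erf_neg, ← neg_div, neg_sub]
  have hs : √(2 * π) ≠ 0 := by positivity
  rw [ga, gb, I22, I1, I21, erfc, s1, n1, n2, add_comm (2 * γ) ν, ← hb]
  generalize erf (b / √2) = E1
  generalize erf ((ν + 2 * γ) / √2) = E2
  generalize rexp (-(ν + 2 * γ) ^ 2 / 2) = F1
  generalize rexp (-(ν - 2 * γ) ^ 2 / 2) = F2
  rw [ha, hb]
  field_simp
  ring

end BoxMin

section LawOfLargeNumbers

lemma integral_abs_le_sqrt_integral_sq {Ω : Type*} [MeasurableSpace Ω] {μ : Measure Ω}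
    [IsProbabilityMeasure μ] {Y : Ω → ℝ} (hY : MemLp Y 2 μ) :
    ∫ ω, |Y ω| ∂μ ≤ √(∫ ω, Y ω ^ 2 ∂μ) := by
  refine Real.le_sqrt_of_sq_le ?_
  have h := variance_nonneg |Y| μ
  rw [variance_eq_sub hY.abs] at h
  simp only [Pi.pow_apply, Pi.abs_apply, sq_abs] at h
  linarith

lemma memLp_comp_eval_stdGaussianPi {τ : Type*} [Fintype τ] {φ : ℝ → ℝ} {p : ENNReal}
    (hφ : MemLp φ p (gaussianReal 0 1)) (a : τ) :
    MemLp (fun ξ => φ (ξ a)) p (stdGaussianPi τ) :=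
  hφ.comp_measurePreserving (measurePreserving_eval (fun _ : τ => gaussianReal 0 1) a)

lemma integrable_abs_avg_sub {τ : Type*} [Fintype τ] {φ : ℝ → ℝ}
    (hφ : MemLp φ 2 (gaussianReal 0 1)) {n : ℕ} (e : Fin n → τ) (c : ℝ) :
    Integrable (fun ξ => |(∑ j, φ (ξ (e j))) / n - c|) (stdGaussianPi τ) :=
  (((integrable_finsetSum _ fun j _ =>
    (memLp_comp_eval_stdGaussianPi hφ (e j)).integrable one_le_two).div_const _).sub
      (integrable_const c)).abs

/-- The weak law of large numbers in mean, with a rate. -/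
lemma integral_abs_avg_sub_le {τ : Type*} [Fintype τ] {φ : ℝ → ℝ}
    (hφ : MemLp φ 2 (gaussianReal 0 1)) {n : ℕ} (hn : 0 < n) {e : Fin n → τ}
    (he : Function.Injective e) :
    ∫ ξ, |(∑ j, φ (ξ (e j))) / n - ∫ x, φ x ∂gaussianReal 0 1| ∂stdGaussianPi τ ≤
      √(Var[φ; gaussianReal 0 1]) / √n := by
  have hn' : (0 : ℝ) < n := by exact_mod_cast hn
  have hm := measurePreserving_comp_stdGaussianPi he
  have hL : ∀ j : Fin n, MemLp (fun ξ : Fin n → ℝ => φ (ξ j)) 2 (stdGaussianPi (Fin n)) :=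
    fun j => memLp_comp_eval_stdGaussianPi hφ j
  have hS : MemLp (fun ξ : Fin n → ℝ => (∑ j, φ (ξ j)) / n) 2 (stdGaussianPi (Fin n)) := by
    simpa only [div_eq_mul_inv] using (memLp_finsetSum _ fun j _ => hL j).mul_const (n : ℝ)⁻¹
  have hY := hS.sub (memLp_const (∫ x, φ x ∂gaussianReal 0 1))
  have h1 : ∫ ξ, |(∑ j, φ (ξ (e j))) / n - ∫ x, φ x ∂gaussianReal 0 1| ∂stdGaussianPi τ =
      ∫ ξ, |(∑ j, φ (ξ j)) / n - ∫ x, φ x ∂gaussianReal 0 1| ∂stdGaussianPi (Fin n) := by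
    rw [← hm.map_eq, integral_map hm.measurable.aemeasurable]
    rw [hm.map_eq]
    exact hY.abs.aestronglyMeasurable
  rw [h1]
  refine (integral_abs_le_sqrt_integral_sq hY).trans_eq ?_
  have hmean : ∫ ξ, (∑ j, φ (ξ j)) / n ∂stdGaussianPi (Fin n) =
      ∫ x, φ x ∂gaussianReal 0 1 := by
    rw [integral_div, integral_finsetSum _ fun j _ => (hL j).integrable one_le_two]
    have : ∀ j : Fin n, ∫ ξ, φ (ξ j) ∂stdGaussianPi (Fin n) = ∫ x, φ x ∂gaussianReal 0 1 := by
      intro j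
      have hj := measurePreserving_eval (fun _ : Fin n => gaussianReal 0 1) j
      conv_rhs => rw [← hj.map_eq]
      rw [integral_map hj.measurable.aemeasurable]
      rw [hj.map_eq]
      exact hφ.aestronglyMeasurable
    simp only [this, Finset.sum_const, Finset.card_univ, Fintype.card_fin, nsmul_eq_mul]
    field_simp
  have hvar : Var[fun ξ : Fin n → ℝ => (∑ j, φ (ξ j)) / n; stdGaussianPi (Fin n)] =
      Var[φ; gaussianReal 0 1] / n := by
    have h2 := variance_sum_pi (ι := Fin n) (μ := fun _ => gaussianReal 0 1)
      (X := fun _ => φ) fun _ => hφ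
    simp only [Finset.sum_const, Finset.card_univ, Fintype.card_fin, nsmul_eq_mul] at h2
    simp only [div_eq_mul_inv]
    rw [variance_mul_const]
    rw [show (fun ξ : Fin n → ℝ => ∑ j, φ (ξ j)) = ∑ j, fun ξ : Fin n → ℝ => φ (ξ j) by
      ext ξ; simp, h2]
    field_simp
  rw [variance_eq_integral hS.aemeasurable, hmean] at hvar
  simp only [Pi.sub_apply]
  rw [hvar, Real.sqrt_div' _ hn'.le]

lemma memLp_sq_gaussianReal : MemLp (fun x : ℝ => x ^ 2) 2 (gaussianReal 0 1) := by
  rw [memLp_two_iff_integrable_sq (by fun_prop)]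
  have h := (memLp_id_gaussianReal (μ := 0) (v := 1) 4).integrable_norm_pow (by norm_num)
  refine h.congr (ae_of_all _ fun x => ?_)
  simp only [id, Real.norm_eq_abs]
  rw [← pow_mul]
  exact (show Even (2 * 2) by decide).pow_abs x

lemma abs_sqrt_div_sqrt_sub_le {α : ℝ} (hα : 0 < α) {n : ℕ} (hn : 0 < n) {q : ℝ} (hq : 0 ≤ q) :
    |√q / √n - √α| ≤ ((α + 1) * |q / ⌈α * n⌉₊ - 1| + 1 / n) / √α := by
  have hn' : (0 : ℝ) < n := by exact_mod_cast hn
  have hn1 : (1 : ℝ) ≤ n := by exact_mod_cast hn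
  have hα' : 0 < √α := Real.sqrt_pos.2 hα
  have hm0 : α * n ≤ ⌈α * n⌉₊ := Nat.le_ceil _
  have hm1 : (⌈α * n⌉₊ : ℝ) < α * n + 1 := Nat.ceil_lt_add_one (by positivity)
  set m : ℝ := (⌈α * n⌉₊ : ℝ)
  have hm : 0 < m := lt_of_lt_of_le (by positivity) hm0
  rw [le_div_iff₀ hα']
  have h1 : |√q / √n - √α| * √α ≤ |q / n - α| := by
    have e : q / n - α = (√q / √n - √α) * (√q / √n + √α) := by
      have e1 : (√q / √n) ^ 2 = q / n := by rw [div_pow, Real.sq_sqrt hq, Real.sq_sqrt hn'.le]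
      have e2 := Real.sq_sqrt hα.le
      linear_combination e2 - e1
    rw [e, abs_mul]
    refine mul_le_mul_of_nonneg_left ?_ (abs_nonneg _)
    have h0 : 0 ≤ √q / √n := by positivity
    rw [abs_of_pos (by positivity)]
    linarith
  refine h1.trans ?_
  have e : q / n - α = (m / n) * (q / m - 1) + (m / n - α) := by field_simp; ring
  rw [e]
  refine (abs_add_le _ _).trans (add_le_add ?_ ?_)
  · rw [abs_mul, abs_of_pos (by positivity : 0 < m / n)]
    refine mul_le_mul_of_nonneg_right ?_ (abs_nonneg _)
    rw [div_le_iff₀ hn']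
    nlinarith
  · have e3 : m / n - α = (m - α * n) / n := by field_simp
    rw [e3, abs_of_nonneg (div_nonneg (by linarith) hn'.le)]
    gcongr
    linarith

end LawOfLargeNumbers

section BoxSphere

/-- The intersection of the cube `[-1/√n, 1/√n]ⁿ` with the sphere of squared radius `c`. -/
def boxSphere (c : ℝ) (n : ℕ) : Set (Fin n → ℝ) :=
  {x | (∀ i, x i ∈ Set.Icc (-(1 / √n)) (1 / √n)) ∧ ∑ i, x i ^ 2 = c}

lemma isCompact_boxSphere (c : ℝ) (n : ℕ) : IsCompact (boxSphere c n) := by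
  have h1 : IsCompact (Set.univ.pi fun _ : Fin n => Set.Icc (-(1 / √n)) (1 / √n)) :=
    isCompact_univ_pi fun _ => isCompact_Icc
  have h2 : IsClosed {x : Fin n → ℝ | ∑ i, x i ^ 2 = c} :=
    isClosed_eq (by fun_prop) continuous_const
  refine (h1.inter_right h2).of_isClosed_subset ?_ fun x hx => ⟨fun i _ => hx.1 i, hx.2⟩
  rw [show boxSphere c n = (Set.univ.pi fun _ : Fin n => Set.Icc (-(1 / √n)) (1 / √n)) ∩
    {x : Fin n → ℝ | ∑ i, x i ^ 2 = c} from
      Set.ext fun x => ⟨fun hx => ⟨fun i _ => hx.1 i, hx.2⟩,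
        fun hx => ⟨fun i => hx.1 i trivial, hx.2⟩⟩]
  exact h1.isClosed.inter h2

lemma const_mem_boxSphere {c : ℝ} (hc : 0 ≤ c) (hc' : c ≤ 1) {n : ℕ} (hn : 0 < n) :
    (fun _ => √c / √n) ∈ boxSphere c n := by
  have hn' : (0 : ℝ) < n := by exact_mod_cast hn
  have h0 : 0 ≤ √c / √n := by positivity
  have h1 : √c / √n ≤ 1 / √n := by
    gcongr
    exact Real.sqrt_le_one.2 hc'
  refine ⟨fun _ => ⟨by linarith, h1⟩, ?_⟩
  simp only [div_pow, Real.sq_sqrt hc, Real.sq_sqrt hn'.le, Finset.sum_const, Finset.card_univ,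
    Fintype.card_fin, nsmul_eq_mul]
  field_simp

variable {c : ℝ} {n : ℕ}

lemma abs_sum_div_sqrt_le {x : Fin n → ℝ} (hn : 0 < n) (hx : x ∈ boxSphere c n) :
    |(∑ j, x j) / √n| ≤ √c := by
  have hn' : (0 : ℝ) < n := by exact_mod_cast hn
  refine Real.abs_le_sqrt ?_
  rw [div_pow, Real.sq_sqrt hn'.le, div_le_iff₀ hn']
  have := sq_sum_le_card_mul_sum_sq (s := Finset.univ) (f := x)
  rw [hx.2] at this
  simpa [mul_comm] using this

lemma sum_sub_sq_boxSphere {x : Fin n → ℝ} (hn : 0 < n) (hx : x ∈ boxSphere c n) :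
    ∑ j, (1 / √n - x j) ^ 2 = 1 - 2 * ((∑ j, x j) / √n) + c := by
  have hn' : (0 : ℝ) < n := by exact_mod_cast hn
  simp only [sub_sq, Finset.sum_add_distrib, Finset.sum_sub_distrib, hx.2, div_pow,
    Real.sq_sqrt hn'.le, one_pow, Finset.sum_const, Finset.card_univ, Fintype.card_fin,
    nsmul_eq_mul, ← Finset.mul_sum]
  field_simp

lemma sum_boxMin_le {x : Fin n → ℝ} (hn : 0 < n) (hx : x ∈ boxSphere c n) {γ : ℝ} (hγ : 0 < γ)
    (ν : ℝ) (h : Fin n → ℝ) :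
    (∑ j, boxMin γ ν (h j)) / n - ν * ((∑ j, x j) / √n) - γ * c ≤ (∑ j, h j * x j) / √n := by
  have hn' : (0 : ℝ) < n := by exact_mod_cast hn
  have hs : 0 < √n := Real.sqrt_pos.2 hn'
  have h1 : ∀ j, boxMin γ ν (h j) ≤ √n * (h j * x j) + ν * √n * x j + γ * n * x j ^ 2 := by
    intro j
    refine (boxMin_le ν hγ (h j) (t := √n * x j) ?_).trans_eq ?_
    · have := hx.1 j
      rw [abs_mul, abs_of_pos hs, ← le_div_iff₀' hs]
      exact abs_le.2 this
    · rw [mul_pow, Real.sq_sqrt hn'.le]; ring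
  have h2 := Finset.sum_le_sum fun j (_ : j ∈ Finset.univ) => h1 j
  simp only [Finset.sum_add_distrib, ← Finset.mul_sum, hx.2] at h2
  have h3 := div_le_div_of_nonneg_right h2 hn'.le
  have e : (√n * ∑ j, h j * x j + ν * √n * ∑ j, x j + γ * n * c) / n =
      (∑ j, h j * x j) / √n + ν * ((∑ j, x j) / √n) + γ * c := by
    have hnn : √(n : ℝ) ^ 2 = n := Real.sq_sqrt hn'.le
    generalize √(n : ℝ) = r at hs hnn
    rw [← hnn]
    field_simp
  linarith

lemma xiRD_le_of_boxSphere {α σ : ℝ} (hσ : 0 < σ) (hc' : c ≤ 1)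
    {ι : Type*} [Fintype ι] {γ ν : ι → ℝ} (hγ : ∀ k, 0 < γ k) {L : ℝ}
    (hL : ∀ c₁, |c₁| ≤ √c → ∃ k, L ≤ xiRD α σ c c₁ (γ k) (ν k)) (hn : 0 < n)
    {x : Fin n → ℝ} (hx : x ∈ boxSphere c n) (G h₀ : ℝ) (h : Fin n → ℝ) :
    √n * (L - (√(4 + σ ^ 2) * |G / √n - √α| + |(∑ j, h j) / n| +
      ∑ k, |(∑ j, boxMin (γ k) (ν k) (h j)) / n -
        ∫ x, boxMin (γ k) (ν k) x ∂gaussianReal 0 1| + σ * |h₀| / √n)) ≤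
      √(∑ j, (1 / √n - x j) ^ 2 + σ ^ 2) * G - (∑ j, h j * (1 / √n - x j) + h₀ * σ) := by
  have hn' : (0 : ℝ) < n := by exact_mod_cast hn
  have hs : 0 < √n := Real.sqrt_pos.2 hn'
  have hc₁ := abs_sum_div_sqrt_le hn hx
  obtain ⟨k, hk⟩ := hL _ hc₁
  have hb := sum_boxMin_le hn hx (hγ k) (ν k) h
  rw [sum_sub_sq_boxSphere hn hx]
  set c₁ := (∑ j, x j) / √n
  have hS : √(1 - 2 * c₁ + c + σ ^ 2) ≤ √(4 + σ ^ 2) := by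
    refine Real.sqrt_le_sqrt ?_
    have := Real.sqrt_le_one.2 hc'
    linarith [(abs_le.1 hc₁).1]
  rw [xiRD] at hk
  set s := √(1 - 2 * c₁ + c + σ ^ 2)
  have hs0 : 0 ≤ s := Real.sqrt_nonneg _
  have hk2 : |(∑ j, boxMin (γ k) (ν k) (h j)) / n -
      ∫ x, boxMin (γ k) (ν k) x ∂gaussianReal 0 1| ≤
      ∑ k, |(∑ j, boxMin (γ k) (ν k) (h j)) / n -
        ∫ x, boxMin (γ k) (ν k) x ∂gaussianReal 0 1| :=
    Finset.single_le_sum (f := fun k => |(∑ j, boxMin (γ k) (ν k) (h j)) / n -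
        ∫ x, boxMin (γ k) (ν k) x ∂gaussianReal 0 1|) (fun _ _ => abs_nonneg _)
        (Finset.mem_univ k)
  have hk3 := neg_abs_le ((∑ j, boxMin (γ k) (ν k) (h j)) / n -
      ∫ x, boxMin (γ k) (ν k) x ∂gaussianReal 0 1)
  have hI := integral_boxMin (ν k) (hγ k)
  have h1 : s * √α - √(4 + σ ^ 2) * |G / √n - √α| ≤ s * (G / √n) := by
    have h1 := mul_le_mul_of_nonneg_right hS (abs_nonneg (G / √n - √α))
    have h2 := mul_le_mul_of_nonneg_left (neg_abs_le (G / √n - √α)) hs0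
    nlinarith
  have h2 : h₀ * σ / √n ≤ σ * |h₀| / √n := by
    rw [mul_comm]
    gcongr
    exact le_abs_self _
  have h3 := le_abs_self ((∑ j, h j) / n)
  have e : s * G - (∑ j, h j * (1 / √n - x j) + h₀ * σ) =
      √n * (s * (G / √n) - ((∑ j, h j) / n - (∑ j, h j * x j) / √n + h₀ * σ / √n)) := by
    have : (∑ j, h j * (1 / √n - x j)) = (∑ j, h j) / √n - ∑ j, h j * x j := by
      simp only [mul_sub, Finset.sum_sub_distrib, mul_one_div, Finset.sum_div]
    rw [this]
    have hnn : √(n : ℝ) ^ 2 = n := Real.sq_sqrt hn'.le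
    clear_value s
    clear hI hk hk2 hk3 hb hc₁ h1 h2 h3
    generalize √(n : ℝ) = r at hs hnn ⊢
    rw [← hnn]
    field_simp
  rw [e]
  refine mul_le_mul_of_nonneg_left ?_ hs.le
  linarith

end BoxSphere

lemma memLp_sum_mul_eval_stdGaussianPi {κ : Type*} [Fintype κ] (w : κ → ℝ) :
    MemLp (fun ξ : κ → ℝ => ∑ a, w a * ξ a) 2 (stdGaussianPi κ) :=
  memLp_finsetSum _ fun a _ => (memLp_comp_eval_stdGaussianPi
    (φ := id) (memLp_id_gaussianReal' 2 (by simp)) a).const_mul (w a)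

lemma integral_sq_sum_mul_stdGaussianPi {κ : Type*} [Fintype κ] (w : κ → ℝ) :
    ∫ ξ, (∑ a, w a * ξ a) ^ 2 ∂stdGaussianPi κ = ∑ a, w a ^ 2 := by
  have h0 : ∫ ξ, (∑ a, w a * ξ a) ∂stdGaussianPi κ = 0 := by
    rw [integral_finsetSum _ fun a _ => (integrable_eval_stdGaussianPi a).const_mul (w a)]
    refine Finset.sum_eq_zero fun a _ => ?_
    have ha := measurePreserving_eval (fun _ : κ => gaussianReal 0 1) a
    have h1 : ∫ ξ, ξ a ∂stdGaussianPi κ = ∫ x, x ∂gaussianReal 0 1 := by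
      rw [← ha.map_eq, integral_map ha.measurable.aemeasurable (by fun_prop)]
    rw [integral_const_mul, h1, integral_id_gaussianReal, mul_zero]
  have h2 := variance_sum_pi (ι := κ) (μ := fun _ => gaussianReal 0 1)
    (X := fun a x => w a * x) fun a => (memLp_id_gaussianReal' 2 (by simp)).const_mul (w a)
  rw [show (∑ a, fun ξ : κ → ℝ => w a * ξ a) = fun ξ : κ → ℝ => ∑ a, w a * ξ a by
    ext ξ; simp, variance_of_integral_eq_zero
      (memLp_sum_mul_eval_stdGaussianPi w).aemeasurable h0] at h2
  rw [h2]
  refine Finset.sum_congr rfl fun a _ => ?_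
  rw [variance_const_mul, variance_fun_id_gaussianReal]
  simp

lemma integral_sInf_le {m n : ℕ} {T : Set (Fin n → ℝ)} (hT : IsCompact T) {x : Fin n → ℝ}
    (hx : x ∈ T) (x₀ : Fin n → ℝ) (σ : ℝ) :
    ∫ p : (Fin m → Fin n → ℝ) × (Fin m → ℝ),
        sInf ((fun x => √(∑ i, (∑ j, p.1 i j * (x₀ j - x j) + σ * p.2 i) ^ 2)) '' T)
        ∂((Measure.pi fun _ => Measure.pi fun _ => gaussianReal 0 1).prod
            (Measure.pi fun _ => gaussianReal 0 1)) ≤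
      √(m * (∑ j, (x₀ j - x j) ^ 2 + σ ^ 2)) := by
  let w : Fin n ⊕ Unit → ℝ := Sum.elim (fun j => x₀ j - x j) fun _ => σ
  let e : Fin m → Fin n ⊕ Unit → (Fin m × (Fin n ⊕ Unit)) ⊕ Unit := fun i a => Sum.inl (i, a)
  have hM := measurePreserving_matrix_vector m n
  have he : ∀ i, MeasurePreserving (fun ξ a => ξ (e i a)) (stdGaussianPi _) (stdGaussianPi _) :=
    fun i => measurePreserving_comp_stdGaussianPi fun a b h => by simpa [e] using h
  have hL : ∀ i, MemLp (fun ξ => ∑ a, w a * ξ (e i a)) 2 (stdGaussianPi _) := fun i =>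
    (memLp_sum_mul_eval_stdGaussianPi w).comp_measurePreserving (he i)
  have hI : ∀ i, ∫ ξ, (∑ a, w a * ξ (e i a)) ^ 2 ∂stdGaussianPi _ = ∑ a, w a ^ 2 := fun i => by
    rw [← integral_sq_sum_mul_stdGaussianPi w]
    conv_rhs => rw [← (he i).map_eq]
    rw [integral_map (he i).measurable.aemeasurable
      (Continuous.aestronglyMeasurable (by fun_prop))]
  have hsq : ∀ ξ : (Fin m × (Fin n ⊕ Unit)) ⊕ Unit → ℝ,
      √(∑ i, (∑ a, w a * ξ (e i a)) ^ 2) ^ 2 = ∑ i, (∑ a, w a * ξ (e i a)) ^ 2 := fun ξ =>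
    Real.sq_sqrt (Finset.sum_nonneg fun _ _ => sq_nonneg _)
  have hY : MemLp (fun ξ => √(∑ i, (∑ a, w a * ξ (e i a)) ^ 2)) 2 (stdGaussianPi _) := by
    rw [memLp_two_iff_integrable_sq (Continuous.aestronglyMeasurable (by fun_prop))]
    simp only [hsq]
    exact integrable_finsetSum _ fun i _ => (hL i).integrable_sq
  have hcont : Continuous fun p : (Fin m → Fin n → ℝ) × (Fin m → ℝ) =>
      sInf ((fun x => √(∑ i, (∑ j, p.1 i j * (x₀ j - x j) + σ * p.2 i) ^ 2)) '' T) :=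
    IsCompact.continuous_sInf hT (by fun_prop)
  rw [← hM.map_eq, integral_map hM.measurable.aemeasurable hcont.aestronglyMeasurable]
  have h1 := integral_abs_le_sqrt_integral_sq hY
  simp only [hsq, abs_of_nonneg (Real.sqrt_nonneg _)] at h1
  rw [integral_finsetSum _ fun i _ => (hL i).integrable_sq] at h1
  simp only [hI, Finset.sum_const, Finset.card_univ, Fintype.card_fin, nsmul_eq_mul] at h1
  have hw : ∑ a, w a ^ 2 = ∑ j, (x₀ j - x j) ^ 2 + σ ^ 2 := by simp [w]
  rw [hw] at h1
  refine (integral_mono_of_nonneg (ae_of_all _ fun ξ => ?_) (hY.integrable one_le_two)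
    (ae_of_all _ fun ξ => ?_)).trans h1
  · exact Real.sInf_nonneg (by rintro _ ⟨w, _, rfl⟩; positivity)
  · refine csInf_le ⟨0, by rintro _ ⟨w, _, rfl⟩; positivity⟩ ⟨x, hx, ?_⟩
    simp [w, e, mul_comm]

lemma sqrt_mul_div_sqrt_le {α : ℝ} (hα : 0 < α) {n : ℕ} (hn : 0 < n) {K : ℝ} (hK : 0 ≤ K) :
    K / √⌈α * n⌉₊ ≤ K / √α / √n := by
  rw [div_div, ← Real.sqrt_mul hα.le]
  have : (0 : ℝ) < n := by exact_mod_cast hn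
  gcongr
  exact Nat.le_ceil _

theorem exists_integral_sInf_boxSphere_ge {α σ c : ℝ} (hα : 0 < α) (hσ : 0 < σ) (hc : 0 < c)
    (hc' : c ≤ 1) {ι : Type*} [Fintype ι] {γ ν : ι → ℝ} (hγ : ∀ k, 0 < γ k) {L : ℝ}
    (hL : ∀ c₁, |c₁| ≤ √c → ∃ k, L ≤ xiRD α σ c c₁ (γ k) (ν k)) :
    ∃ C : ℝ, ∀ n : ℕ, 0 < n → L - C / √n ≤ (1 / √n) *
      ∫ p : (Fin ⌈α * n⌉₊ → Fin n → ℝ) × (Fin ⌈α * n⌉₊ → ℝ),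
        sInf ((fun x => √(∑ i, (∑ j, p.1 i j * (1 / √n - x j) + σ * p.2 i) ^ 2)) ''
          boxSphere c n)
        ∂((Measure.pi fun _ => Measure.pi fun _ => gaussianReal 0 1).prod
            (Measure.pi fun _ => gaussianReal 0 1)) := by
  set S := √(4 + σ ^ 2)
  set K₀ := √(Var[fun x => x ^ 2; gaussianReal 0 1])
  set K₁ := √(Var[fun x => x; gaussianReal 0 1])
  set B : ι → ℝ := fun k => √(Var[boxMin (γ k) (ν k); gaussianReal 0 1])
  refine ⟨S * (((α + 1) * (K₀ / √α) + 1) / √α) + K₁ + ∑ k, B k + σ + S, fun n hn => ?_⟩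
  have hn' : (0 : ℝ) < n := by exact_mod_cast hn
  have hn1 : (1 : ℝ) ≤ n := by exact_mod_cast hn
  have hs : 0 < √n := Real.sqrt_pos.2 hn'
  set m := ⌈α * n⌉₊
  have hm : 0 < m := Nat.ceil_pos.2 (by positivity)
  let μ := stdGaussianPi (Fin m ⊕ (Fin n ⊕ Unit))
  let X₀ : (Fin m ⊕ (Fin n ⊕ Unit) → ℝ) → ℝ := fun ξ =>
    |(∑ k, ξ (Sum.inl k) ^ 2) / m - ∫ x, x ^ 2 ∂gaussianReal 0 1|
  let X₁ : (Fin m ⊕ (Fin n ⊕ Unit) → ℝ) → ℝ := fun ξ =>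
    |(∑ j, ξ (Sum.inr (Sum.inl j))) / n - ∫ x, x ∂gaussianReal 0 1|
  let X₂ : ι → (Fin m ⊕ (Fin n ⊕ Unit) → ℝ) → ℝ := fun k ξ =>
    |(∑ j, boxMin (γ k) (ν k) (ξ (Sum.inr (Sum.inl j)))) / n -
      ∫ x, boxMin (γ k) (ν k) x ∂gaussianReal 0 1|
  let X₃ : (Fin m ⊕ (Fin n ⊕ Unit) → ℝ) → ℝ := fun ξ => |ξ (Sum.inr (Sum.inr ()))|
  have hid : MemLp (fun x : ℝ => x) 2 (gaussianReal 0 1) := memLp_id_gaussianReal' 2 (by simp)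
  have einj : Function.Injective fun j : Fin n => (Sum.inr (Sum.inl j) : Fin m ⊕ (Fin n ⊕ Unit)) :=
    Sum.inr_injective.comp Sum.inl_injective
  have i₀ : Integrable X₀ μ := integrable_abs_avg_sub memLp_sq_gaussianReal _ _
  have i₁ : Integrable X₁ μ := integrable_abs_avg_sub hid _ _
  have i₂ : ∀ k, Integrable (X₂ k) μ := fun k =>
    integrable_abs_avg_sub (memLp_boxMin (ν k) (hγ k)) _ _
  have i₃ : Integrable X₃ μ := (integrable_eval_stdGaussianPi _).abs
  have b₀ : ∫ ξ, X₀ ξ ∂μ ≤ K₀ / √α / √n :=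
    (integral_abs_avg_sub_le memLp_sq_gaussianReal hm Sum.inl_injective).trans
      (sqrt_mul_div_sqrt_le hα hn (Real.sqrt_nonneg _))
  have b₁ : ∫ ξ, X₁ ξ ∂μ ≤ K₁ / √n := integral_abs_avg_sub_le hid hn einj
  have b₂ : ∀ k, ∫ ξ, X₂ k ξ ∂μ ≤ B k / √n := fun k =>
    integral_abs_avg_sub_le (memLp_boxMin (ν k) (hγ k)) hn einj
  have b₃ : ∫ ξ, X₃ ξ ∂μ ≤ 1 := integral_abs_eval_stdGaussianPi_le _
  let Z : (Fin m ⊕ (Fin n ⊕ Unit) → ℝ) → ℝ := fun ξ =>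
    S * (((α + 1) * X₀ ξ + 1 / n) / √α) + X₁ ξ + ∑ k, X₂ k ξ + σ * X₃ ξ / √n
  have j₀ : Integrable (fun ξ => S * (((α + 1) * X₀ ξ + 1 / n) / √α)) μ :=
    (((i₀.const_mul _).add (integrable_const _)).div_const _).const_mul _
  have j₂ : Integrable (fun ξ => ∑ k, X₂ k ξ) μ := integrable_finsetSum _ fun k _ => i₂ k
  have j₃ : Integrable (fun ξ => σ * X₃ ξ / √n) μ := (i₃.const_mul _).div_const _
  have j₀₁ : Integrable (fun ξ => S * (((α + 1) * X₀ ξ + 1 / n) / √α) + X₁ ξ) μ := j₀.add i₁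
  have j₀₂ : Integrable (fun ξ => S * (((α + 1) * X₀ ξ + 1 / n) / √α) + X₁ ξ + ∑ k, X₂ k ξ) μ :=
    j₀₁.add j₂
  have hZ : Integrable Z μ := j₀₂.add j₃
  have hZb : ∫ ξ, Z ξ ∂μ ≤
      (S * (((α + 1) * (K₀ / √α) + 1) / √α) + K₁ + ∑ k, B k + σ) / √n := by
    have e : ∫ ξ, Z ξ ∂μ = S * (((α + 1) * ∫ ξ, X₀ ξ ∂μ) + 1 / n) / √α + ∫ ξ, X₁ ξ ∂μ +
        ∑ k, ∫ ξ, X₂ k ξ ∂μ + σ * (∫ ξ, X₃ ξ ∂μ) / √n := by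
      simp only [Z]
      rw [integral_add j₀₂ j₃, integral_add j₀₁ j₂, integral_add j₀ i₁,
        integral_finsetSum _ fun k _ => i₂ k, integral_const_mul, integral_div,
        integral_add (i₀.const_mul _) (integrable_const _)]
      simp [integral_div, integral_const_mul, mul_div_assoc]
    have hsn : 1 / (n : ℝ) ≤ 1 / √n := by
      gcongr
      exact Real.sqrt_le_iff.2 ⟨hn'.le, by nlinarith⟩
    have b₂' := Finset.sum_le_sum fun k (_ : k ∈ Finset.univ) => b₂ k
    rw [← Finset.sum_div] at b₂'
    have h1 : S * (((α + 1) * ∫ ξ, X₀ ξ ∂μ) + 1 / n) / √α ≤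
        S * ((α + 1) * (K₀ / √α / √n) + 1 / √n) / √α := by
      gcongr
    have h2 : σ * (∫ ξ, X₃ ξ ∂μ) / √n ≤ σ * 1 / √n := by gcongr
    rw [e]
    refine (add_le_add (add_le_add (add_le_add h1 b₁) b₂') h2).trans_eq ?_
    field_simp
  have hxb : ∀ x ∈ boxSphere c n, √(∑ j, (1 / √n - x j) ^ 2 + σ ^ 2) ≤ S := fun x hx => by
    rw [sum_sub_sq_boxSphere hn hx]
    refine Real.sqrt_le_sqrt ?_
    have := Real.sqrt_le_one.2 hc'
    linarith [(abs_le.1 (abs_sum_div_sqrt_le hn hx)).1]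
  have hmain := integral_le_integral_sInf_add (m := m) (isCompact_boxSphere c n)
    ⟨_, const_mem_boxSphere hc.le hc' hn⟩ (fun _ => 1 / √n) σ hxb
    (f := fun ξ => √n * (L - Z ξ)) (((integrable_const L).sub hZ).const_mul _) fun ξ x hx => by
      refine (mul_le_mul_of_nonneg_left ?_ hs.le).trans
        (xiRD_le_of_boxSphere hσ hc' hγ hL hn hx _ _ _)
      have h0 := abs_sqrt_div_sqrt_sub_le hα hn
        (q := ∑ k, ξ (Sum.inl k : Fin m ⊕ (Fin n ⊕ Unit)) ^ 2)
        (Finset.sum_nonneg fun _ _ => sq_nonneg _)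
      have h1 := mul_le_mul_of_nonneg_left h0 (Real.sqrt_nonneg (4 + σ ^ 2))
      simp only [Z, X₀, X₁, X₂, X₃, integral_sq_gaussianReal, integral_id_gaussianReal, sub_zero]
      linarith
  rw [integral_const_mul, integral_sub (integrable_const L) hZ, integral_const,
    probReal_univ, one_smul] at hmain
  rw [one_div_mul_eq_div, le_div_iff₀ hs]
  have e : ∀ a : ℝ, a / √n * √n = a := fun a => div_mul_cancel₀ a hs.ne'
  have := mul_le_mul_of_nonneg_left hZb hs.le
  rw [mul_comm √n (_ / √n), e] at this
  rw [sub_mul, e]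
  linarith

lemma continuous_xiRD (α σ c γ ν : ℝ) : Continuous fun c₁ => xiRD α σ c c₁ γ ν := by
  simp only [xiRD]
  fun_prop

lemma exists_finite_xiRD_ge {α σ c L : ℝ}
    (hL : ∀ c₁, |c₁| ≤ √c → ∃ γ ν, 0 < γ ∧ L < xiRD α σ c c₁ γ ν) :
    ∃ (ι : Type) (_ : Fintype ι) (γ ν : ι → ℝ), (∀ k, 0 < γ k) ∧
      ∀ c₁, |c₁| ≤ √c → ∃ k, L ≤ xiRD α σ c c₁ (γ k) (ν k) := by
  choose! γ ν hγ h using hL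
  obtain ⟨t, ht⟩ := (isCompact_Icc (a := -√c) (b := √c)).elim_finite_subcover
    (fun i : {c₁ // |c₁| ≤ √c} => {c₁ | L < xiRD α σ c c₁ (γ i) (ν i)})
    (fun i => isOpen_lt continuous_const (continuous_xiRD ..))
    fun c₁ hc₁ => Set.mem_iUnion.2 ⟨⟨c₁, abs_le.2 hc₁⟩, h _ (abs_le.2 hc₁)⟩
  refine ⟨t, inferInstance, fun k => γ k, fun k => ν k, fun k => hγ _ k.1.2, fun c₁ hc₁ => ?_⟩
  obtain ⟨k, hk, hlt⟩ := Set.mem_iUnion₂.1 (ht (abs_le.1 hc₁))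
  exact ⟨⟨k, hk⟩, le_of_lt hlt⟩

lemma integral_sInf_boxSphere_le {α : ℝ} (hα : 0 < α) (σ : ℝ) {c : ℝ} (hc : 0 ≤ c) (hc' : c ≤ 1)
    {n : ℕ} (hn : 0 < n) :
    (1 / √n) * ∫ p : (Fin ⌈α * n⌉₊ → Fin n → ℝ) × (Fin ⌈α * n⌉₊ → ℝ),
        sInf ((fun x => √(∑ i, (∑ j, p.1 i j * (1 / √n - x j) + σ * p.2 i) ^ 2)) ''
          boxSphere c n)
        ∂((Measure.pi fun _ => Measure.pi fun _ => gaussianReal 0 1).prod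
            (Measure.pi fun _ => gaussianReal 0 1)) ≤ √((α + 1) * (4 + σ ^ 2)) := by
  have hn' : (0 : ℝ) < n := by exact_mod_cast hn
  have hn1 : (1 : ℝ) ≤ n := by exact_mod_cast hn
  have hx := const_mem_boxSphere hc hc' hn
  have h := integral_sInf_le (m := ⌈α * n⌉₊) (isCompact_boxSphere c n) hx (fun _ => 1 / √n) σ
  rw [one_div_mul_eq_div, div_le_iff₀ (Real.sqrt_pos.2 hn'), ← Real.sqrt_mul (by positivity)]
  refine h.trans (Real.sqrt_le_sqrt ?_)
  have h1 : (⌈α * n⌉₊ : ℝ) ≤ (α + 1) * n := by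
    have := Nat.ceil_lt_add_one (R := ℝ) (a := α * n) (by positivity)
    linarith
  have h2 := sum_sub_sq_boxSphere hn hx
  have h3 := (abs_le.1 (abs_sum_div_sqrt_le hn hx)).1
  have h4 := Real.sqrt_le_one.2 hc'
  rw [mul_right_comm]
  refine mul_le_mul h1 (by rw [h2]; linarith) ?_ (by positivity)
  exact add_nonneg (Finset.sum_nonneg fun _ _ => sq_nonneg _) (sq_nonneg σ)

/-- the liminf of the (normalized, expected) primal optimum over the
sphere-intersected cube is lower bounded by `inf_{|c1| ≤ √c2} sup_{γ>0,ν} ξ_RD`. -/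
theorem clup_rdt_lower_bound_c2
    (α σ c2 : ℝ) (hα : 0 < α) (hσ : 0 < σ) (hc2 : 0 < c2) (hc2' : c2 ≤ 1)
    (T : (n : ℕ) → Set (Fin n → ℝ))
    (hT : ∀ n, T n =
      {x | (∀ i, x i ∈ Set.Icc (-(1 / Real.sqrt n)) (1 / Real.sqrt n)) ∧
           (∑ i, (x i)^2) = c2})
    (ξ : ℕ → ℝ)
    (hξ : ∀ n : ℕ, ξ n = (1 / Real.sqrt n) *
      ∫ p : (Fin (Nat.ceil (α * n)) → Fin n → ℝ) × (Fin (Nat.ceil (α * n)) → ℝ),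
        sInf ((fun x : Fin n → ℝ =>
          Real.sqrt (∑ i, (∑ j, p.1 i j * (1 / Real.sqrt n - x j) + σ * p.2 i)^2)) '' T n)
        ∂((Measure.pi fun _ => Measure.pi fun _ => gaussianReal 0 1).prod
            (Measure.pi fun _ => gaussianReal 0 1))) :
    (⨅ c1 : {c : ℝ // |c| ≤ Real.sqrt c2}, ⨆ γ : {g : ℝ // 0 < g}, ⨆ ν : ℝ,
        xiRD α σ c2 c1.1 γ.1 ν) ≤ atTop.liminf ξ := by
  obtain rfl : T = boxSphere c2 := funext hT
  have h0 : ∀ n, 0 ≤ ξ n := fun n => by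
    rw [hξ]
    refine mul_nonneg (by positivity) (integral_nonneg fun p => Real.sInf_nonneg ?_)
    rintro _ ⟨x, _, rfl⟩
    positivity
  have hcob : IsCoboundedUnder (· ≥ ·) atTop ξ := by
    refine IsBoundedUnder.isCoboundedUnder_ge (isBoundedUnder_of_eventually_le
      (a := √((α + 1) * (4 + σ ^ 2))) ?_)
    filter_upwards [eventually_gt_atTop 0] with n hn
    rw [hξ]
    exact integral_sInf_boxSphere_le hα σ hc2.le hc2' hn
  rcases le_or_gt (⨅ c1 : {c // |c| ≤ √c2}, ⨆ γ : {g : ℝ // 0 < g}, ⨆ ν : ℝ,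
    xiRD α σ c2 c1.1 γ.1 ν) 0 with hL | hL
  · exact hL.trans (le_liminf_of_le hcob (Eventually.of_forall h0))
  set L := ⨅ c1 : {c // |c| ≤ √c2}, ⨆ γ : {g : ℝ // 0 < g}, ⨆ ν : ℝ, xiRD α σ c2 c1.1 γ.1 ν
  have hbdd : BddBelow (Set.range fun c1 : {c // |c| ≤ √c2} =>
      ⨆ γ : {g : ℝ // 0 < g}, ⨆ ν : ℝ, xiRD α σ c2 c1.1 γ.1 ν) := by
    by_contra h
    exact hL.ne' (Real.iInf_of_not_bddBelow h)
  refine le_of_forall_pos_le_add fun ε hε => ?_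
  have : Nonempty {g : ℝ // 0 < g} := ⟨⟨1, one_pos⟩⟩
  obtain ⟨ι, _, γ, ν, hγ, hk⟩ := exists_finite_xiRD_ge (α := α) (σ := σ) (c := c2)
    (L := L - ε / 2) fun c₁ hc₁ => by
      have h1 : L - ε / 2 < ⨆ γ : {g : ℝ // 0 < g}, ⨆ ν : ℝ, xiRD α σ c2 c₁ γ.1 ν :=
        (sub_lt_self L (half_pos hε)).trans_le (ciInf_le hbdd ⟨c₁, hc₁⟩)
      obtain ⟨γ, h2⟩ := exists_lt_of_lt_ciSup h1
      obtain ⟨ν, h3⟩ := exists_lt_of_lt_ciSup h2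
      exact ⟨γ, ν, γ.2, h3⟩
  obtain ⟨C, hC⟩ := exists_integral_sInf_boxSphere_ge hα hσ hc2 hc2' hγ hk
  have hlim : Tendsto (fun n : ℕ => C / √n) atTop (nhds 0) :=
    tendsto_const_nhds.div_atTop (tendsto_sqrt_atTop.comp tendsto_natCast_atTop_atTop)
  rw [← sub_le_iff_le_add]
  refine le_liminf_of_le hcob ?_
  filter_upwards [hlim.eventually_lt_const (half_pos hε), eventually_gt_atTop 0] with n h1 h2
  have := hC n h2
  rw [hξ]
  linarith
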